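/- arXiv:hep-th/9412231 — 5 statements merged into one kernel-verified Lean document; each statement's English description precedes it below -/
import Mathlib

section
/- Let ω¹ and ω² be two symbols with ∑_{i≥1}|ω¹_i|² < ∞ and ∑_{i≥1}|ω²_i|² < ∞, and assume ∑_{i≥1}|ω¹_{−i}·ω²_i| < ∞. Then for all multi-indices η and ν the family (v_{η,μ}(ω¹)·v_{μ,ν}(ω²)), indexed by all multi-indices μ, is absolutely summable and ∑_μ v_{η,μ}(ω¹)·v_{μ,ν}(ω²) = exp(−∑_{i≥1} ω¹_{−i}·ω²_i)·v_{η,ν}(ω¹+ω²), where ω¹+ω² is the symbol with components ω¹_{±i}+ω²_{±i}. (This expresses the operator identity V(ω¹)V(ω²) = exp(−∑_{i≥1} ω¹_{−i}ω²_i)·V(ω¹+ω²) on the span of the basis vectors.) -/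
/-- A multi-index: a finitely supported function from the positive integers to `ℕ`. -/
abbrev MultiIndex := ℕ+ →₀ ℕ

/-- The polynomial `m_{n,m}(x,y) = ∑_{j=0}^{min(n,m)} (n choose j)(m choose j) j! x^{n-j} y^{m-j}`. -/
def mPoly {R : Type*} [CommSemiring R] (n m : ℕ) (x y : R) : R :=
  ∑ j ∈ Finset.range (min n m + 1),
    (n.choose j : R) * (m.choose j : R) * (Nat.factorial j : R) * x ^ (n - j) * y ^ (m - j)

/-- `η! = ∏_{i≥1} η_i!`. -/
def miFact (η : MultiIndex) : ℕ := ∏ i ∈ η.support, Nat.factorial (η i)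

/-- The matrix element `v_{η,ν}(ω) = (η!·ν!)^{-1/2} ∏_{i≥1} m_{η_i,ν_i}(ω_i, -ω_{-i})`;
the product is finite since `m_{0,0} = 1`. -/
noncomputable def vElem (ωp ωm : ℕ+ → ℂ) (η ν : MultiIndex) : ℂ :=
  ((1 / Real.sqrt ((miFact η : ℝ) * (miFact ν : ℝ))) : ℝ) *
    ∏ i ∈ η.support ∪ ν.support, mPoly (η i) (ν i) (ωp i) (-ωm i)

open Filter Topology in
lemma aux_mPoly_eq (n k N : ℕ) (x y : ℂ) (h : min n k + 1 ≤ N) :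
    mPoly n k x y = ∑ j ∈ Finset.range N,
      (n.choose j : ℂ) * (k.choose j : ℂ) * (Nat.factorial j : ℂ) * x ^ (n - j) * y ^ (k - j) := by
  unfold mPoly
  apply Finset.sum_subset
  · intro j hj; simp only [Finset.mem_range] at *; omega
  · intro j _ hj
    simp only [Finset.mem_range, not_lt] at hj
    rcases le_total n k with hnk | hnk
    · rw [Nat.choose_eq_zero_of_lt (show n < j by omega)]; simp
    · rw [Nat.choose_eq_zero_of_lt (show k < j by omega)]; simp

lemma aux_mPoly_symm (n k : ℕ) (x y : ℂ) : mPoly n k x y = mPoly k n y x := by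
  unfold mPoly
  rw [min_comm]
  apply Finset.sum_congr rfl
  intros; ring

lemma aux_mPoly_zero_left (k : ℕ) (x y : ℂ) : mPoly 0 k x y = y ^ k := by
  simp [mPoly]

lemma aux_mPoly_zero_right (k : ℕ) (x y : ℂ) : mPoly k 0 x y = x ^ k := by
  simp [mPoly]

lemma aux_mPoly_succ (n k : ℕ) (x y : ℂ) :
    mPoly (n + 1) k x y = x * mPoly n k x y + k * mPoly n (k - 1) x y := by
  rcases k with _ | k
  · simp [aux_mPoly_zero_right, pow_succ']
  rw [aux_mPoly_eq (n + 1) (k + 1) (n + 2) x y (by omega),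
    aux_mPoly_eq n (k + 1) (n + 2) x y (by omega),
    aux_mPoly_eq n (k + 1 - 1) (n + 1) x y (by omega),
    Finset.sum_range_succ', Finset.sum_range_succ' _ (n + 1), mul_add, Finset.mul_sum,
    Finset.mul_sum, add_right_comm, ← Finset.sum_add_distrib]
  congr 1
  · apply Finset.sum_congr rfl
    intro j _
    have e1 : ((k + 1).choose (j + 1) : ℂ) * ((j + 1).factorial : ℂ)
        = (k + 1) * (k.choose j : ℂ) * (j.factorial : ℂ) := by
      have := Nat.add_one_mul_choose_eq k j
      have h2 : ((k : ℂ) + 1) * (k.choose j : ℂ) = ((k + 1).choose (j + 1) : ℂ) * (j + 1) := by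
        exact_mod_cast this
      rw [h2, Nat.factorial_succ]; push_cast; ring
    have e2 : (n.choose (j + 1) : ℂ) * x ^ (n - j)
        = (n.choose (j + 1) : ℂ) * (x * x ^ (n - (j + 1))) := by
      rcases Nat.lt_or_ge j n with h | h
      · rw [← pow_succ', show n - (j + 1) + 1 = n - j by omega]
      · rw [Nat.choose_eq_zero_of_lt (show n < j + 1 by omega)]; simp
    rw [Nat.choose_succ_succ n j]
    simp only [Nat.add_sub_add_right, Nat.add_sub_cancel]
    push_cast
    linear_combination ((n.choose j : ℂ)) * x ^ (n - j) * y ^ (k - j) * e1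
      + ((k + 1).choose (j + 1) : ℂ) * ((j + 1).factorial : ℂ) * y ^ (k - j) * e2
  · simp [pow_succ']; ring

lemma aux_mPoly_succ_right (n k : ℕ) (x y : ℂ) :
    mPoly n (k + 1) x y = y * mPoly n k x y + n * mPoly (n - 1) k x y := by
  rw [aux_mPoly_symm, aux_mPoly_succ, aux_mPoly_symm k, aux_mPoly_symm k]

lemma aux_congr {α : Type*} {g h : α → ℂ} {L M : ℂ} (hg : HasSum g L) (hh : ∀ k, h k = g k)
    (hM : M = L) : HasSum h M := by
  rw [hM, funext hh]; exact hg

lemma aux_shift {g h : ℕ → ℂ} {L : ℂ} (hg : HasSum g L) (h0 : h 0 = 0)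
    (hh : ∀ k, h (k + 1) = g k) : HasSum h L := by
  rw [← hasSum_nat_add_iff' 1]
  simpa [h0, hh] using hg

lemma aux_fact (k : ℕ) : ((k + 1).factorial : ℂ)⁻¹ * ((k + 1 : ℕ) : ℂ) = (k.factorial : ℂ)⁻¹ := by
  have h1 : ((k : ℂ) + 1) ≠ 0 := by exact_mod_cast Nat.succ_ne_zero k
  have h2 : (k.factorial : ℂ) ≠ 0 := by exact_mod_cast Nat.factorial_ne_zero k
  rw [Nat.factorial_succ]; push_cast
  field_simp

lemma aux_one_zero (b c d : ℂ) (m : ℕ) :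
    HasSum (fun k : ℕ => (k.factorial : ℂ)⁻¹ * b ^ k * mPoly k m c d)
      (Complex.exp (b * c) * (b + d) ^ m) := by
  induction m with
  | zero =>
    have := NormedSpace.expSeries_div_hasSum_exp (b * c)
    rw [← Complex.exp_eq_exp_ℂ] at this
    simp only [aux_mPoly_zero_right, pow_zero, mul_one]
    refine aux_congr this (fun k => ?_) rfl
    rw [mul_pow]; ring
  | succ m ih =>
    have h1 := ih.mul_left d
    have h2 : HasSum (fun k : ℕ => (k.factorial : ℂ)⁻¹ * b ^ k * (k * mPoly (k - 1) m c d))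
        (b * (Complex.exp (b * c) * (b + d) ^ m)) := by
      refine aux_shift (ih.mul_left b) (by simp) ?_
      intro k
      rw [← aux_fact k, Nat.add_sub_cancel]; ring
    refine aux_congr (h1.add h2) (fun k => ?_) ?_
    · rw [aux_mPoly_succ_right]; ring
    · ring

lemma aux_one (a b c d : ℂ) (n : ℕ) : ∀ m : ℕ,
    HasSum (fun k : ℕ => (k.factorial : ℂ)⁻¹ * mPoly n k a b * mPoly k m c d)
      (Complex.exp (b * c) * mPoly n m (a + c) (b + d)) := by
  induction n with
  | zero =>
    intro m
    simpa only [aux_mPoly_zero_left] using aux_one_zero b c d m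
  | succ n ih =>
    intro m
    have h2 : HasSum (fun k : ℕ => (k.factorial : ℂ)⁻¹ * (k * mPoly n (k - 1) a b) * mPoly k m c d)
        (c * (Complex.exp (b * c) * mPoly n m (a + c) (b + d))
          + m * (Complex.exp (b * c) * mPoly n (m - 1) (a + c) (b + d))) := by
      refine aux_shift (((ih m).mul_left c).add ((ih (m - 1)).mul_left (m : ℂ))) (by simp) ?_
      intro k
      rw [← aux_fact k, Nat.add_sub_cancel, aux_mPoly_succ k m]; ring
    refine aux_congr (((ih m).mul_left a).add h2) (fun k => ?_) ?_
    · rw [aux_mPoly_succ]; ring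
    · rw [aux_mPoly_succ]; ring

noncomputable def auxEquiv (i : ℕ+) (S : Finset ℕ+) (hi : i ∉ S) :
    ℕ × {μ : MultiIndex // μ.support ⊆ S} ≃ {μ : MultiIndex // μ.support ⊆ insert i S} where
  toFun p := ⟨p.2.1.update i p.1, by
    intro j hj
    by_cases h : j = i
    · simp [h]
    · have := p.2.2
      apply Finset.mem_insert_of_mem
      apply this
      simpa [Finsupp.mem_support_iff, Function.update_of_ne h] using hj⟩
  invFun μ := (μ.1 i, ⟨μ.1.erase i, by
    intro j hj
    rw [Finsupp.support_erase, Finset.mem_erase] at hj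
    exact (Finset.mem_insert.1 (μ.2 hj.2)).resolve_left hj.1⟩)
  left_inv p := by
    have h0 : p.2.1 i = 0 := by
      by_contra h
      exact hi (p.2.2 (Finsupp.mem_support_iff.2 h))
    ext j
    · simp
    · by_cases h : j = i
      · subst h; simp [h0]
      · simp [Finsupp.erase_ne h, Function.update_of_ne h]
  right_inv μ := by
    ext j
    by_cases h : j = i
    · subst h; simp
    · simp [Finsupp.erase_ne h, Function.update_of_ne h]

lemma aux_mul {R : Type*} [NormedField R] {α β : Type*} (f : α → R) (g : β → R) (a b : R)
    (hf : HasSum f a) (hg : HasSum g b) (h : Summable fun p : α × β => f p.1 * g p.2) :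
    HasSum (fun p : α × β => f p.1 * g p.2) (a * b) :=
  hf.mul hg h

lemma aux_fin {R : Type*} [NormedField R] [CompleteSpace R] (f : ℕ+ → ℕ → R)
    (hf : ∀ i, Summable fun k => ‖f i k‖) (S : Finset ℕ+) :
    Summable (fun μ : {μ : MultiIndex // μ.support ⊆ S} => ‖∏ i ∈ S, f i (μ.1 i)‖) ∧
    HasSum (fun μ : {μ : MultiIndex // μ.support ⊆ S} => ∏ i ∈ S, f i (μ.1 i))
      (∏ i ∈ S, ∑' k, f i k) := by
  induction S using Finset.induction with
  | empty =>
    haveI : Unique {μ : MultiIndex // μ.support ⊆ (∅ : Finset ℕ+)} :=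
      ⟨⟨⟨0, by simp⟩⟩, fun μ => by
        apply Subtype.ext
        exact Finsupp.support_eq_empty.1 (Finset.subset_empty.1 μ.2)⟩
    constructor
    · exact (hasSum_fintype _).summable
    · simpa using hasSum_fintype (fun μ : {μ : MultiIndex // μ.support ⊆ (∅ : Finset ℕ+)} => (1 : R))
  | insert i S hi ih =>
    have key : ∀ p : ℕ × {μ : MultiIndex // μ.support ⊆ S},
        ∏ j ∈ insert i S, f j ((auxEquiv i S hi p).1 j) = f i p.1 * ∏ j ∈ S, f j (p.2.1 j) := by
      intro p
      rw [Finset.prod_insert hi]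
      congr 1
      · simp [auxEquiv]
      · apply Finset.prod_congr rfl
        intro j hj
        have : j ≠ i := fun h => hi (h ▸ hj)
        simp [auxEquiv, Function.update_of_ne this]
    have hs := (hf i).mul_norm ih.1
    constructor
    · rw [← (auxEquiv i S hi).summable_iff]
      simpa only [Function.comp_def, key] using hs
    · rw [← (auxEquiv i S hi).hasSum_iff, Finset.prod_insert hi]
      simp only [Function.comp_def, key]
      have hs' : Summable (fun p : ℕ × {μ : MultiIndex // μ.support ⊆ S} =>
        f i p.1 * ∏ j ∈ S, f j (p.2.1 j)) := Summable.of_norm hs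
      have hi' : HasSum (f i) (∑' k, f i k) := (Summable.of_norm (hf i)).hasSum
      exact aux_mul (f i) (fun μ : {μ : MultiIndex // μ.support ⊆ S} => ∏ j ∈ S, f j (μ.1 j))
        _ _ hi' ih.2 hs'

open Filter Topology in
lemma aux_inf (f : ℕ+ → ℕ → ℂ) (z w : ℕ+ → ℂ) (T : Finset ℕ+) (F : MultiIndex → ℂ)
    (hF : ∀ (μ : MultiIndex) (S : Finset ℕ+), T ⊆ S → μ.support ⊆ S → F μ = ∏ i ∈ S, f i (μ i))
    (hf : ∀ i, HasSum (f i) (Complex.exp (z i) * w i)) (hz : Summable fun i => ‖z i‖)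
    (hout : ∀ i, i ∉ T → ∀ k, f i k = (k.factorial : ℂ)⁻¹ * z i ^ k)
    (hw : ∀ i, i ∉ T → w i = 1) :
    Summable (fun μ => ‖F μ‖) ∧ HasSum F (Complex.exp (∑' i, z i) * ∏ i ∈ T, w i) := by
  classical
  have hfn : ∀ i, Summable fun k => ‖f i k‖ := fun i => (hf i).summable.norm
  have hA : ∀ i, i ∉ T → ∑' k, ‖f i k‖ = Real.exp ‖z i‖ := by
    intro i hi
    have := NormedSpace.expSeries_div_hasSum_exp ‖z i‖
    rw [← Real.exp_eq_exp_ℝ] at this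
    rw [← this.tsum_eq]
    congr 1; ext k
    rw [hout i hi]; simp; ring
  have hsum : Summable (fun μ => ‖F μ‖) := by
    apply summable_of_sum_le (c := (∏ i ∈ T, ∑' k, ‖f i k‖) * Real.exp (∑' i, ‖z i‖))
    · intro μ; exact norm_nonneg _
    intro u
    set S : Finset ℕ+ := T ∪ u.biUnion (fun μ => μ.support) with hS
    have hTS : T ⊆ S := Finset.subset_union_left
    have huS : ∀ μ ∈ u, μ.support ⊆ S := fun μ hμ =>
      (Finset.subset_biUnion_of_mem (fun μ : MultiIndex => μ.support) hμ).trans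
        Finset.subset_union_right
    have h1 := (aux_fin (fun i k => ‖f i k‖) (by simpa using hfn) S).2
    have h2 : ∑ μ ∈ u, ‖F μ‖ ≤ ∏ i ∈ S, ∑' k, ‖f i k‖ := by
      have h3 := sum_le_hasSum (u.subtype (fun μ => μ.support ⊆ S))
        (fun μ _ => Finset.prod_nonneg (fun i _ => norm_nonneg (f i (μ.1 i)))) h1
      refine le_trans (le_of_eq ?_) h3
      rw [← Finset.sum_subtype_of_mem (fun μ => ‖F μ‖) huS]
      apply Finset.sum_congr rfl
      intro μ _
      rw [hF μ.1 S hTS μ.2, norm_prod]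
    refine h2.trans ?_
    rw [← Finset.prod_sdiff hTS, mul_comm]
    refine mul_le_mul_of_nonneg_left ?_
      (Finset.prod_nonneg (fun i _ => tsum_nonneg (fun k => norm_nonneg _)))
    rw [Finset.prod_congr rfl (fun i hi => hA i (Finset.mem_sdiff.1 hi).2), ← Real.exp_sum]
    exact Real.exp_le_exp.2 (hz.sum_le_tsum _ (fun i _ => norm_nonneg _))
  refine ⟨hsum, ?_⟩
  have hlim : Tendsto (fun S : Finset ℕ+ =>
      ∑' μ : MultiIndex, ({μ : MultiIndex | μ.support ⊆ S}).indicator F μ) atTop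
      (𝓝 (∑' μ, F μ)) := by
    apply tendsto_tsum_of_dominated_convergence hsum
    · intro μ
      apply tendsto_const_nhds.congr'
      filter_upwards [eventually_ge_atTop μ.support] with S hS
      rw [Set.indicator_of_mem]
      exact hS
    · exact Eventually.of_forall (fun S μ => norm_indicator_le_norm_self _ _)
  have hlim2 : Tendsto (fun S : Finset ℕ+ =>
      ∑' μ : MultiIndex, ({μ : MultiIndex | μ.support ⊆ S}).indicator F μ) atTop
      (𝓝 (Complex.exp (∑' i, z i) * ∏ i ∈ T, w i)) := by
    have h4 : Tendsto (fun S : Finset ℕ+ => Complex.exp (∑ i ∈ S, z i) * ∏ i ∈ T, w i) atTop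
        (𝓝 (Complex.exp (∑' i, z i) * ∏ i ∈ T, w i)) :=
      ((Complex.continuous_exp.tendsto _).comp hz.of_norm.hasSum).mul_const _
    apply h4.congr'
    filter_upwards [eventually_ge_atTop T] with S hS
    rw [← tsum_subtype]
    have h5 := (aux_fin f hfn S).2
    have h6 : HasSum (fun μ : ({μ : MultiIndex | μ.support ⊆ S} : Set MultiIndex) => F μ)
        (∏ i ∈ S, ∑' k, f i k) :=
      aux_congr h5 (fun μ => hF μ.1 S hS μ.2) rfl
    rw [h6.tsum_eq, Finset.prod_congr rfl (fun i _ => (hf i).tsum_eq), Finset.prod_mul_distrib,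
      Complex.exp_sum]
    congr 1
    exact Finset.prod_subset hS (fun i _ hi => hw i hi)
  rw [← tendsto_nhds_unique hlim hlim2]
  exact hsum.of_norm.hasSum

lemma aux_miFact (μ : MultiIndex) (S : Finset ℕ+) (h : μ.support ⊆ S) :
    miFact μ = ∏ i ∈ S, (μ i).factorial := by
  unfold miFact
  apply Finset.prod_subset h
  intro i _ hi
  rw [Finsupp.notMem_support_iff.1 hi]; rfl

lemma aux_vElem (p m : ℕ+ → ℂ) (η ν : MultiIndex) (S : Finset ℕ+) (h : η.support ∪ ν.support ⊆ S) :
    vElem p m η ν = ((1 / Real.sqrt ((miFact η : ℝ) * (miFact ν : ℝ))) : ℝ) *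
      ∏ i ∈ S, mPoly (η i) (ν i) (p i) (-m i) := by
  unfold vElem
  congr 1
  apply Finset.prod_subset h
  intro i _ hi
  simp only [Finset.mem_union, Finsupp.mem_support_iff, not_or, not_not] at hi
  rw [hi.1, hi.2, aux_mPoly_zero_left, pow_zero]

lemma aux_sqrt (a b c : ℝ) (ha : 0 ≤ a) (hb : 0 ≤ b) :
    (1 / Real.sqrt (a * b)) * (1 / Real.sqrt (b * c)) = (1 / Real.sqrt (a * c)) * b⁻¹ := by
  rw [Real.sqrt_mul ha, Real.sqrt_mul hb, Real.sqrt_mul ha]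
  have : b⁻¹ = (Real.sqrt b)⁻¹ * (Real.sqrt b)⁻¹ := by
    rw [← mul_inv, Real.mul_self_sqrt hb]
  rw [this]
  simp only [one_div, mul_inv]
  ring

/-- Composition law for vertex operator matrix elements: if `∑|ω¹_i|² < ∞`, `∑|ω²_i|² < ∞`
and `∑_{i≥1} |ω¹_{−i}·ω²_i| < ∞`, then for all multi-indices `η, ν` the family
`(v_{η,μ}(ω¹)·v_{μ,ν}(ω²))_μ` is absolutely summable, and
`∑_μ v_{η,μ}(ω¹)·v_{μ,ν}(ω²) = exp(−∑_{i≥1} ω¹_{−i}ω²_i)·v_{η,ν}(ω¹+ω²)`. -/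
theorem stmt2 (ω1p ω1m ω2p ω2m : ℕ+ → ℂ)
    (h1 : Summable fun i : ℕ+ => ‖ω1p i‖ ^ 2)
    (h2 : Summable fun i : ℕ+ => ‖ω2p i‖ ^ 2)
    (h12 : Summable fun i : ℕ+ => ‖ω1m i * ω2p i‖)
    (η ν : MultiIndex) :
    Summable (fun μ : MultiIndex => ‖vElem ω1p ω1m η μ * vElem ω2p ω2m μ ν‖) ∧
    ∑' μ : MultiIndex, vElem ω1p ω1m η μ * vElem ω2p ω2m μ ν
      = Complex.exp (-∑' i : ℕ+, ω1m i * ω2p i) *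
        vElem (fun i => ω1p i + ω2p i) (fun i => ω1m i + ω2m i) η ν := by
  classical
  set T : Finset ℕ+ := η.support ∪ ν.support with hT
  set C : ℂ := ((1 / Real.sqrt ((miFact η : ℝ) * (miFact ν : ℝ)) : ℝ) : ℂ) with hC
  set f : ℕ+ → ℕ → ℂ := fun i k => (k.factorial : ℂ)⁻¹ * mPoly (η i) k (ω1p i) (-ω1m i)
    * mPoly k (ν i) (ω2p i) (-ω2m i) with hf
  set F : MultiIndex → ℂ := fun μ => ∏ i ∈ T ∪ μ.support, f i (μ i) with hF
  have hη : ∀ i, i ∉ T → η i = 0 ∧ ν i = 0 := by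
    intro i hi
    simpa [hT, not_or] using hi
  have main := aux_inf f (fun i => -ω1m i * ω2p i)
    (fun i => mPoly (η i) (ν i) (ω1p i + ω2p i) (-ω1m i + -ω2m i)) T F
    (by
      intro μ S hTS hμS
      apply Finset.prod_subset (Finset.union_subset hTS hμS)
      intro i _ hi
      rw [Finset.mem_union, not_or, Finsupp.notMem_support_iff] at hi
      simp [hf, hi.2, (hη i hi.1).1, (hη i hi.1).2, aux_mPoly_zero_left])
    (fun i => aux_one _ _ _ _ _ _)
    (by simpa using h12)
    (by
      intro i hi k
      simp only [hf, (hη i hi).1, (hη i hi).2, aux_mPoly_zero_left, aux_mPoly_zero_right]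
      rw [mul_pow]; ring)
    (by
      intro i hi
      simp only [(hη i hi).1, (hη i hi).2, aux_mPoly_zero_left, pow_zero])
  have hterm : ∀ μ : MultiIndex, vElem ω1p ω1m η μ * vElem ω2p ω2m μ ν = C * F μ := by
    intro μ
    have s1 : η.support ∪ μ.support ⊆ T ∪ μ.support :=
      Finset.union_subset_union_left Finset.subset_union_left
    have s2 : μ.support ∪ ν.support ⊆ T ∪ μ.support :=
      Finset.union_subset Finset.subset_union_right
        (Finset.subset_union_right.trans Finset.subset_union_left)
    have hsq := aux_sqrt (miFact η) (miFact μ) (miFact ν) (Nat.cast_nonneg _) (Nat.cast_nonneg _)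
    have hsq' := congrArg (fun r : ℝ => (r : ℂ)) hsq
    simp only [Complex.ofReal_mul] at hsq'
    have hμ : (((miFact μ : ℝ)⁻¹ : ℝ) : ℂ) = ∏ i ∈ T ∪ μ.support, ((μ i).factorial : ℂ)⁻¹ := by
      rw [aux_miFact μ _ (Finset.subset_union_right (s₁ := T))]
      push_cast
      rw [Finset.prod_inv_distrib]
    rw [aux_vElem _ _ _ _ _ s1, aux_vElem _ _ _ _ _ s2, mul_mul_mul_comm, hsq', hμ]
    simp only [hF, hf, Finset.prod_mul_distrib]
    ring
  simp only [hterm]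
  constructor
  · simpa only [norm_mul] using main.1.mul_left ‖C‖
  · rw [(main.2.mul_left C).tsum_eq]
    have e1 : ∑' i : ℕ+, -ω1m i * ω2p i = -∑' i : ℕ+, ω1m i * ω2p i := by
      rw [← tsum_neg]; simp only [neg_mul]
    rw [e1]
    unfold vElem
    simp only [neg_add]
    rw [← hC]
    ring
end

section
/- Assume ∑_{i≥1}|ω_i|² < ∞ and ∑_{i≥1}|ω_{−i}|² = ∞. Let V(ω)₀ be the densely defined linear operator in H whose domain is the linear span of the basis vectors (e_ν) and which is given by V(ω)₀ e_ν = ∑_η v_{η,ν}(ω)·e_η. Then the adjoint of V(ω)₀ has domain {0}: no nonzero Φ ∈ H admits a constant C with |⟨Φ, V(ω)₀ f⟩| ≤ C·‖f‖ for all f in the domain. In particular V(ω)₀, and every extension of it, is not a closable operator. -/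
namespace S4
open Finset

lemma mul_hasSum {𝕜 α β : Type*} [RCLike 𝕜] (f : α → 𝕜) (g : β → 𝕜) (F G : 𝕜)
    (hf : HasSum f F) (hg : HasSum g G) : HasSum (fun p : α × β => f p.1 * g p.2) (F * G) := by
  have h1 : Summable fun a => ‖f a‖ := hf.summable.norm
  have h2 : Summable fun a => ‖g a‖ := hg.summable.norm
  have hsm : Summable (fun p : α × β => f p.1 * g p.2) := summable_mul_of_summable_norm h1 h2
  have := hsm.hasSum
  rwa [← tsum_mul_tsum_of_summable_norm h1 h2, hf.tsum_eq, hg.tsum_eq] at this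

lemma prod_hasSum {𝕜 : Type*} [RCLike 𝕜] (f : ℕ+ → ℕ → 𝕜) (F : ℕ+ → 𝕜) (s : Finset ℕ+)
    (h : ∀ i ∈ s, HasSum (f i) (F i)) :
    HasSum (fun ν : MultiIndex => if ν.support ⊆ s then ∏ i ∈ s, f i (ν i) else 0)
      (∏ i ∈ s, F i) := by
  induction s using Finset.induction_on with
  | empty =>
    have : (fun ν : MultiIndex => if ν.support ⊆ (∅ : Finset ℕ+) then ∏ i ∈ (∅ : Finset ℕ+), f i (ν i) else (0:𝕜))
        = fun ν => if ν = 0 then 1 else 0 := by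
      funext ν; simp
    rw [this, Finset.prod_empty]
    exact hasSum_ite_eq 0 1
  | insert i s his ih =>
    have ih' := ih (fun j hj => h j (Finset.mem_insert_of_mem hj))
    have hi := h i (Finset.mem_insert_self _ _)
    have hp : HasSum (fun p : ℕ × MultiIndex => f i p.1 *
        (if p.2.support ⊆ s then ∏ j ∈ s, f j (p.2 j) else 0)) (F i * ∏ j ∈ s, F j) := by
      exact mul_hasSum (f i) (fun ν : MultiIndex => if ν.support ⊆ s then ∏ j ∈ s, f j (ν j) else 0) _ _ hi ih'
    rw [Finset.prod_insert his]
    have key : ∀ p : ℕ × MultiIndex, p.2.support ⊆ s → ∀ j, (p.2 + Finsupp.single i p.1) j = if j = i then p.1 else p.2 j := by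
      intro p hp j
      have : p.2 i = 0 := by
        by_contra hc
        exact his (hp (Finsupp.mem_support_iff.2 hc))
      by_cases hj : j = i
      · subst hj; simp [this]
      · simp [hj, Finsupp.single_apply, Ne.symm hj]
    have hsupp : ∀ p : Function.support (fun p : ℕ × MultiIndex => f i p.1 *
        (if p.2.support ⊆ s then ∏ j ∈ s, f j (p.2 j) else 0)), p.1.2.support ⊆ s := by
      rintro ⟨p, hp⟩
      by_contra hc
      apply hp
      simp [hc]
    refine (hasSum_iff_hasSum_of_ne_zero_bij (fun p => p.1.2 + Finsupp.single i p.1.1) ?_ ?_ ?_).2 hp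
    · intro p q hpq
      have hpq' : ∀ j, (p.1.2 + Finsupp.single i p.1.1) j = (q.1.2 + Finsupp.single i q.1.1) j := fun j => by
        have := DFunLike.congr_fun hpq j
        exact this
      simp only [key _ (hsupp p), key _ (hsupp q)] at hpq'
      have hz : ∀ p : Function.support (fun p : ℕ × MultiIndex => f i p.1 *
        (if p.2.support ⊆ s then ∏ j ∈ s, f j (p.2 j) else 0)), p.1.2 i = 0 := by
        intro p
        by_contra hc
        exact his (hsupp p (Finsupp.mem_support_iff.2 hc))
      apply Subtype.ext
      apply Prod.ext
      · simpa using hpq' i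
      · ext j
        by_cases hj : j = i
        · subst hj; rw [hz p, hz q]
        · simpa [hj] using hpq' j
    · intro ν hν
      have hνs : ν.support ⊆ insert i s := by
        by_contra hc
        apply hν; simp [hc]
      have he : (ν.erase i).support ⊆ s := by
        intro j hj
        rw [Finsupp.support_erase, Finset.mem_erase] at hj
        have := hνs hj.2
        rw [Finset.mem_insert] at this
        tauto
      have hval : (∏ j ∈ s, f j (ν.erase i j)) = ∏ j ∈ s, f j (ν j) := by
        refine Finset.prod_congr rfl fun j hj => ?_
        rw [Finsupp.erase_ne]
        rintro rfl; exact his hj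
      refine ⟨⟨(ν i, ν.erase i), ?_⟩, ?_⟩
      · simp only [Function.mem_support, he, if_true, hval]
        simp only [Function.mem_support, hνs, if_true, Finset.prod_insert his] at hν
        exact hν
      · exact Finsupp.erase_add_single i ν
    · intro p
      have hs := hsupp p
      have h1 : (p.1.2 + Finsupp.single i p.1.1).support ⊆ insert i s := by
        intro j hj
        rw [Finsupp.mem_support_iff, key _ hs] at hj
        by_cases hji : j = i
        · simp [hji]
        · rw [if_neg hji] at hj
          exact Finset.mem_insert_of_mem (hs (Finsupp.mem_support_iff.2 hj))
      simp only [h1, hs, if_true, Finset.prod_insert his, key _ hs]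
      congr 1
      refine Finset.prod_congr rfl fun j hj => ?_
      rw [if_neg]
      rintro rfl; exact his hj

lemma shift_hasSum {𝕜 : Type*} [RCLike 𝕜] (g : ℕ → 𝕜) (G : 𝕜) (h : HasSum g G) (j : ℕ) :
    HasSum (fun m => if j ≤ m then g (m - j) else 0) G := by
  have hinj : Function.Injective (fun m : ℕ => m + j) := fun a b h => by simpa using h
  refine (hinj.hasSum_iff ?_).1 ?_
  · intro m hm
    rw [if_neg]
    intro hle
    exact hm ⟨m - j, by simp; omega⟩
  · have : ((fun m => if j ≤ m then g (m - j) else 0) ∘ fun m : ℕ => m + j) = g := by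
      funext m; simp
    rw [this]; exact h

lemma one_hasSum {𝕜 : Type*} [RCLike 𝕜] (n : ℕ) (x y z : 𝕜) :
    HasSum (fun m => mPoly n m x y * z ^ m / (m.factorial : 𝕜))
      ((x + z) ^ n * NormedSpace.exp (y * z)) := by
  have hexp : HasSum (fun m : ℕ => (y * z) ^ m / (m.factorial : 𝕜)) (NormedSpace.exp (y * z)) :=
    NormedSpace.expSeries_div_hasSum_exp (y * z)
  have := hasSum_sum (s := Finset.range (n + 1)) (fun j _ =>
    (shift_hasSum _ _ hexp j).mul_left ((n.choose j : 𝕜) * x ^ (n - j) * z ^ j))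
  rw [← Finset.sum_mul] at this
  have hb : ∑ j ∈ Finset.range (n+1), (n.choose j : 𝕜) * x ^ (n - j) * z ^ j = (x + z) ^ n := by
    rw [add_comm x z, add_pow]
    refine Finset.sum_congr rfl fun j _ => by ring
  rw [hb] at this
  refine Eq.mpr (congrArg (fun f => HasSum f _) (funext ?_)) this
  intro m
  unfold mPoly
  have hsub : Finset.range (min n m + 1) ⊆ Finset.range (n + 1) := by
    intro j; simp only [Finset.mem_range]; omega
  rw [← Finset.sum_subset hsub, mul_div_assoc, Finset.sum_mul]
  · refine Finset.sum_congr rfl fun j hj => ?_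
    have hjm : j ≤ m := by simp only [Finset.mem_range] at hj; omega
    rw [if_pos hjm]
    obtain ⟨k, rfl⟩ := Nat.exists_eq_add_of_le hjm
    have hc : ((j + k).choose j : 𝕜) * (j.factorial : 𝕜) * (k.factorial : 𝕜) = ((j + k).factorial : 𝕜) := by
      have := Nat.add_choose_mul_factorial_mul_factorial j k
      rw [Nat.choose_symm_add.symm] at this
      exact_mod_cast this
    have h1 : ((j + k).factorial : 𝕜) ≠ 0 := by exact_mod_cast Nat.factorial_ne_zero _
    have h2 : (k.factorial : 𝕜) ≠ 0 := by exact_mod_cast Nat.factorial_ne_zero _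
    rw [Nat.add_sub_cancel_left]
    field_simp
    rw [← hc]
    ring
  · intro j hj hj'
    rw [if_neg, mul_zero]
    simp only [Finset.mem_range] at hj hj'
    omega

lemma norm_mPoly_le (n m : ℕ) (x y : ℂ) : ‖mPoly n m x y‖ ≤ mPoly n m ‖x‖ ‖y‖ := by
  unfold mPoly
  refine (norm_sum_le _ _).trans (le_of_eq ?_)
  simp

/-- weight -/
noncomputable def wt (a : ℕ+ → ℝ) (η : MultiIndex) : ℝ := ∏ i ∈ η.support, a i ^ η i / (η i).factorial

lemma wt_nonneg {a : ℕ+ → ℝ} (ha : ∀ i, 0 ≤ a i) (η : MultiIndex) : 0 ≤ wt a η :=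
  Finset.prod_nonneg fun i _ => div_nonneg (pow_nonneg (ha i) _) (by positivity)

lemma wt_sum_le {a : ℕ+ → ℝ} (ha : ∀ i, 0 ≤ a i) (hs : Summable a) (T : Finset MultiIndex) :
    ∑ η ∈ T, wt a η ≤ Real.exp (∑' i, a i) := by
  classical
  set s := T.biUnion (fun η => η.support)
  have h := prod_hasSum (fun i m => a i ^ m / (m.factorial : ℝ)) (fun i => Real.exp (a i)) s
    (fun i _ => by
      have := NormedSpace.expSeries_div_hasSum_exp (a i)
      rwa [← Real.exp_eq_exp_ℝ] at this)
  have h2 : ∑ η ∈ T, wt a η ≤ ∏ i ∈ s, Real.exp (a i) := by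
    have h3 := sum_le_hasSum T (fun ν _ => by
      split_ifs
      · exact Finset.prod_nonneg fun i _ => div_nonneg (pow_nonneg (ha i) _) (by positivity)
      · exact le_rfl) h
    refine le_trans (le_of_eq ?_) h3
    refine Finset.sum_congr rfl fun η hη => ?_
    have hsub : η.support ⊆ s := Finset.subset_biUnion_of_mem (fun η : MultiIndex => η.support) hη
    rw [if_pos hsub]
    unfold wt
    refine Finset.prod_subset hsub fun i _ hi => ?_
    rw [Finsupp.notMem_support_iff] at hi
    simp [hi]
  refine h2.trans ?_
  rw [← Real.exp_sum]
  exact Real.exp_le_exp.2 (hs.sum_le_tsum _ fun i _ => ha i)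

lemma wt_summable {a : ℕ+ → ℝ} (ha : ∀ i, 0 ≤ a i) (hs : Summable a) : Summable (wt a) :=
  summable_of_sum_le (wt_nonneg ha) (wt_sum_le ha hs)

/-- coherent coefficient -/
noncomputable def coh {𝕜 : Type*} [RCLike 𝕜] (w : ℕ+ → 𝕜) (η : MultiIndex) : 𝕜 :=
  (∏ i ∈ η.support, w i ^ η i) * ((1 / Real.sqrt (miFact η : ℝ) : ℝ) : 𝕜)

lemma miFact_pos (η : MultiIndex) : 0 < miFact η :=
  Finset.prod_pos fun _ _ => Nat.factorial_pos _

lemma norm_coh (w : ℕ+ → ℂ) (η : MultiIndex) : ‖coh w η‖ = coh (fun i => ‖w i‖) η := by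
  unfold coh
  simp [norm_prod, abs_of_nonneg (Real.sqrt_nonneg _)]

lemma coh_sq (w : ℕ+ → ℝ) (η : MultiIndex) : coh w η ^ 2 = wt (fun i => w i ^ 2) η := by
  unfold coh wt
  have h : ((1 / Real.sqrt (miFact η : ℝ))) ^ 2 = 1 / (miFact η : ℝ) := by
    rw [div_pow, Real.sq_sqrt (by positivity)]; simp
  rw [mul_pow, Finset.prod_div_distrib]
  simp only [RCLike.ofReal_real_eq_id, id]
  rw [h, ← Finset.prod_pow, mul_one_div]
  congr 1
  · exact Finset.prod_congr rfl fun i _ => by ring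
  · unfold miFact; push_cast; rfl

lemma coh_nonneg {w : ℕ+ → ℝ} (hw : ∀ i, 0 ≤ w i) (η : MultiIndex) : 0 ≤ coh w η := by
  unfold coh
  simp only [RCLike.ofReal_real_eq_id, id]
  exact mul_nonneg (Finset.prod_nonneg fun i _ => pow_nonneg (hw i) _) (by positivity)

lemma coh_mono {w w' : ℕ+ → ℝ} (hw : ∀ i, 0 ≤ w i) (hww : ∀ i, w i ≤ w' i) (η : MultiIndex) :
    coh w η ≤ coh w' η := by
  unfold coh
  simp only [RCLike.ofReal_real_eq_id, id]
  refine mul_le_mul_of_nonneg_right ?_ (by positivity)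
  exact Finset.prod_le_prod (fun i _ => pow_nonneg (hw i) _)
    fun i _ => pow_le_pow_left₀ (hw i) (hww i) _

lemma dom_summable {Φ : MultiIndex → ℂ} (hΦ : Memℓp Φ 2) {W : ℕ+ → ℝ}
    (hs : Summable fun i => W i ^ 2) : Summable fun η => ‖Φ η‖ * coh W η := by
  have h1 : Summable fun η => ‖Φ η‖ ^ 2 := by
    have := (memℓp_gen_iff (by norm_num)).1 hΦ
    simpa using this
  have h2 : Summable fun η => coh W η ^ 2 := by
    simp_rw [coh_sq]
    exact wt_summable (fun i => sq_nonneg _) hs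
  refine Summable.of_norm_bounded (h1.add h2) fun η => ?_
  rw [norm_mul, norm_norm, Real.norm_eq_abs, ← sq_abs (coh W η)]
  nlinarith [sq_nonneg (‖Φ η‖ - |coh W η|), sq_nonneg (‖Φ η‖), sq_nonneg (|coh W η|)]

end S4
namespace S4
open Finset

/-- unnormalised matrix element times coherent coefficient -/
noncomputable def uEl {𝕜 : Type*} [RCLike 𝕜] (x y z : ℕ+ → 𝕜) (t : Finset ℕ+) (η ν : MultiIndex) : 𝕜 :=
  if ν.support ⊆ t then ∏ i ∈ t, mPoly (η i) (ν i) (x i) (y i) * z i ^ (ν i) / ((ν i).factorial : 𝕜)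
  else 0

lemma uEl_hasSum {𝕜 : Type*} [RCLike 𝕜] (x y z : ℕ+ → 𝕜) (t : Finset ℕ+) (η : MultiIndex) :
    HasSum (uEl x y z t η) (∏ i ∈ t, (x i + z i) ^ η i * NormedSpace.exp (y i * z i)) :=
  prod_hasSum (fun i m => mPoly (η i) m (x i) (y i) * z i ^ m / (m.factorial : 𝕜)) _ t
    (fun i _ => one_hasSum (η i) (x i) (y i) (z i))

lemma norm_uEl_le (x y z : ℕ+ → ℂ) (t : Finset ℕ+) (η ν : MultiIndex) :
    ‖uEl x y z t η ν‖ ≤ uEl (fun i => ‖x i‖) (fun i => ‖y i‖) (fun i => ‖z i‖) t η ν := by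
  unfold uEl
  split_ifs
  · rw [norm_prod]
    refine Finset.prod_le_prod (fun i _ => norm_nonneg _) fun i _ => ?_
    rw [norm_div, norm_mul, norm_pow, Complex.norm_natCast]
    gcongr
    exact norm_mPoly_le _ _ _ _
  · simp

lemma uEl_nonneg (x y z : ℕ+ → ℂ) (t : Finset ℕ+) (η ν : MultiIndex) :
    0 ≤ uEl (fun i => ‖x i‖) (fun i => ‖y i‖) (fun i => ‖z i‖) t η ν :=
  (norm_nonneg _).trans (norm_uEl_le x y z t η ν)

lemma vElem_mul_coh (ωp ωm z : ℕ+ → ℂ) (s : Finset ℕ+) (hz : ∀ i, i ∉ s → z i = 0)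
    (η ν : MultiIndex) :
    coh z ν * vElem ωp ωm η ν = ((1 / Real.sqrt (miFact η : ℝ) : ℝ) : ℂ) *
      uEl ωp (fun i => - ωm i) z (η.support ∪ s) η ν := by
  unfold uEl
  split_ifs with h
  · have e1 : ∏ i ∈ η.support ∪ ν.support, mPoly (η i) (ν i) (ωp i) (-ωm i)
        = ∏ i ∈ η.support ∪ s, mPoly (η i) (ν i) (ωp i) (-ωm i) := by
      refine Finset.prod_subset (Finset.union_subset Finset.subset_union_left h) fun i _ hi => ?_
      simp only [Finset.mem_union, Finsupp.mem_support_iff, not_or, not_not] at hi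
      simp [hi.1, hi.2, mPoly]
    have e2 : ∏ i ∈ ν.support, z i ^ ν i = ∏ i ∈ η.support ∪ s, z i ^ ν i := by
      refine Finset.prod_subset h fun i _ hi => ?_
      rw [Finsupp.notMem_support_iff] at hi
      simp [hi]
    have e3 : (miFact ν : ℂ) = ∏ i ∈ η.support ∪ s, ((ν i).factorial : ℂ) := by
      unfold miFact
      push_cast
      refine Finset.prod_subset h fun i _ hi => ?_
      rw [Finsupp.notMem_support_iff] at hi
      simp [hi]
    rw [Finset.prod_div_distrib, Finset.prod_mul_distrib, ← e1, ← e2, ← e3]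
    unfold coh vElem
    rw [Real.sqrt_mul (by positivity)]
    have hν : (miFact ν : ℂ) = ((Real.sqrt (miFact ν : ℝ) : ℝ) : ℂ) * ((Real.sqrt (miFact ν : ℝ) : ℝ) : ℂ) := by
      rw [← Complex.ofReal_mul, Real.mul_self_sqrt (by positivity)]; simp
    have p1 : ((Real.sqrt (miFact ν : ℝ) : ℝ) : ℂ) ≠ 0 := by
      have := miFact_pos ν
      have : (0:ℝ) < Real.sqrt (miFact ν : ℝ) := Real.sqrt_pos.2 (by exact_mod_cast this)
      exact_mod_cast this.ne'
    have p2 : ((Real.sqrt (miFact η : ℝ) : ℝ) : ℂ) ≠ 0 := by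
      have := miFact_pos η
      have : (0:ℝ) < Real.sqrt (miFact η : ℝ) := Real.sqrt_pos.2 (by exact_mod_cast this)
      exact_mod_cast this.ne'
    rw [hν]
    simp only [Complex.coe_algebraMap, Complex.ofReal_div, Complex.ofReal_mul, Complex.ofReal_one]
    field_simp
  · obtain ⟨i, hi, hi'⟩ := Finset.not_subset.1 h
    have : coh z ν = 0 := by
      unfold coh
      rw [Finset.prod_eq_zero hi, zero_mul]
      rw [hz i (fun h => hi' (Finset.mem_union_right _ h))]
      exact zero_pow (Finsupp.mem_support_iff.1 hi)
    rw [this]; simp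

lemma prod_coh {𝕜 : Type*} [RCLike 𝕜] (x y z : ℕ+ → 𝕜) (s : Finset ℕ+)
    (hz : ∀ i, i ∉ s → z i = 0) (η : MultiIndex) :
    ((1 / Real.sqrt (miFact η : ℝ) : ℝ) : 𝕜) *
      ∏ i ∈ η.support ∪ s, (x i + z i) ^ η i * NormedSpace.exp (y i * z i)
    = (∏ i ∈ s, NormedSpace.exp (y i * z i)) * coh (fun i => x i + z i) η := by
  rw [Finset.prod_mul_distrib]
  have e1 : ∏ i ∈ η.support, (x i + z i) ^ η i = ∏ i ∈ η.support ∪ s, (x i + z i) ^ η i := by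
    refine Finset.prod_subset Finset.subset_union_left fun i _ hi => ?_
    rw [Finsupp.notMem_support_iff] at hi
    simp [hi]
  have e2 : ∏ i ∈ s, NormedSpace.exp (y i * z i) = ∏ i ∈ η.support ∪ s, NormedSpace.exp (y i * z i) := by
    refine Finset.prod_subset Finset.subset_union_right fun i _ hi => ?_
    simp [hz i hi]
  rw [← e1, ← e2]
  unfold coh
  ring

lemma key_bound (ωp ωm : ℕ+ → ℂ)
    (h1 : Summable fun i : ℕ+ => ‖ωp i‖ ^ 2)
    (Φ : MultiIndex → ℂ) (hΦ : Memℓp Φ 2) (C : ℝ)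
    (hC : ∀ f : MultiIndex →₀ ℂ,
      ‖∑' η : MultiIndex, (starRingEnd ℂ) (Φ η) * ∑ ν ∈ f.support, f ν * vElem ωp ωm η ν‖ ≤
        C * Real.sqrt (∑ ν ∈ f.support, ‖f ν‖ ^ 2))
    (z : ℕ+ → ℂ) (s : Finset ℕ+) (hz : ∀ i, i ∉ s → z i = 0) :
    ‖(∏ i ∈ s, NormedSpace.exp (-ωm i * z i)) *
      ∑' η : MultiIndex, (starRingEnd ℂ) (Φ η) * coh (fun i => ωp i + z i) η‖
      ≤ |C| * Real.sqrt (Real.exp (∑' i, ‖z i‖ ^ 2)) := by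
  classical
  set A := ∏ i ∈ s, NormedSpace.exp (-ωm i * z i) with hA
  set B : ℝ := ∏ i ∈ s, NormedSpace.exp (‖-ωm i‖ * ‖z i‖) with hB
  have hzs : Summable fun i => ‖z i‖ ^ 2 :=
    summable_of_ne_finset_zero (s := s) (fun i hi => by simp [hz i hi])
  have hWs : Summable fun i => (‖ωp i‖ + ‖z i‖) ^ 2 := by
    refine Summable.of_nonneg_of_le (fun i => sq_nonneg _) (fun i => ?_) ((h1.add hzs).mul_left 2)
    nlinarith [sq_nonneg (‖ωp i‖ - ‖z i‖)]
  have hlim : Filter.Tendsto (fun S : Finset MultiIndex => ∑' η : MultiIndex, (starRingEnd ℂ) (Φ η) *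
      ∑ ν ∈ S, coh z ν * vElem ωp ωm η ν) Filter.atTop
      (nhds (∑' η : MultiIndex, (starRingEnd ℂ) (Φ η) * (A * coh (fun i => ωp i + z i) η))) := by
    refine tendsto_tsum_of_dominated_convergence
      (bound := fun η => B * (‖Φ η‖ * coh (fun i => ‖ωp i‖ + ‖z i‖) η))
      ((dom_summable hΦ hWs).mul_left B) ?_ ?_
    · intro η
      refine Filter.Tendsto.const_mul _ ?_
      have := (uEl_hasSum ωp (fun i => -ωm i) z (η.support ∪ s) η).mul_left
        (((1 / Real.sqrt (miFact η : ℝ) : ℝ) : ℂ))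
      have h2 := prod_coh ωp (fun i => -ωm i) z s hz η
      simp only [Complex.coe_algebraMap] at h2
      rw [← h2] 
      simp_rw [vElem_mul_coh ωp ωm z s hz η]
      exact this
    · refine Filter.Eventually.of_forall fun S η => ?_
      rw [norm_mul, RCLike.norm_conj]
      have h2 := prod_coh (fun i => ‖ωp i‖) (fun i => ‖-ωm i‖) (fun i => ‖z i‖) s
        (fun i hi => by simp [hz i hi]) η
      rw [mul_left_comm, ← h2]
      refine mul_le_mul_of_nonneg_left ?_ (norm_nonneg _)
      simp_rw [vElem_mul_coh ωp ωm z s hz η]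
      rw [← Finset.mul_sum, norm_mul]
      have hu := uEl_hasSum (fun i => ‖ωp i‖) (fun i => ‖-ωm i‖) (fun i => ‖z i‖) (η.support ∪ s) η
      refine mul_le_mul ?_ ?_ (norm_nonneg _) ?_
      · rw [Complex.norm_real, Real.norm_eq_abs, abs_of_nonneg (by positivity)]
        rfl
      · refine (norm_sum_le _ _).trans ?_
        refine le_trans (Finset.sum_le_sum fun ν _ => norm_uEl_le _ _ _ _ _ _) ?_
        exact sum_le_hasSum S (fun ν _ => uEl_nonneg ωp (fun i => -ωm i) z _ _ _) hu
      · simp only [RCLike.ofReal_real_eq_id, id]; positivity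
  have e : A * ∑' η : MultiIndex, (starRingEnd ℂ) (Φ η) * coh (fun i => ωp i + z i) η
      = ∑' η : MultiIndex, (starRingEnd ℂ) (Φ η) * (A * coh (fun i => ωp i + z i) η) := by
    rw [← tsum_mul_left]
    exact tsum_congr fun η => by ring
  rw [e]
  refine le_of_tendsto hlim.norm (Filter.Eventually.of_forall fun S => ?_)
  set f : MultiIndex →₀ ℂ := Finsupp.onFinset S (fun ν => if ν ∈ S then coh z ν else 0)
    (fun ν h => by by_contra hc; simp [hc] at h) with hf
  have hfv : ∀ ν ∈ S, f ν = coh z ν := fun ν hν => by simp [hf, hν]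
  have hsub : f.support ⊆ S := Finsupp.support_onFinset_subset
  have hx := hC f
  have e1 : ∀ η, ∑ ν ∈ f.support, f ν * vElem ωp ωm η ν = ∑ ν ∈ S, coh z ν * vElem ωp ωm η ν := by
    intro η
    rw [Finset.sum_subset hsub]
    · exact Finset.sum_congr rfl fun ν hν => by rw [hfv ν hν]
    · intro ν _ hν
      rw [Finsupp.notMem_support_iff.1 hν, zero_mul]
  have e2 : ∑ ν ∈ f.support, ‖f ν‖ ^ 2 ≤ Real.exp (∑' i, ‖z i‖ ^ 2) := by
    refine le_trans (le_of_eq ?_) (wt_sum_le (fun i => sq_nonneg ‖z i‖) hzs f.support)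
    refine Finset.sum_congr rfl fun ν hν => ?_
    rw [hfv ν (hsub hν), norm_coh, coh_sq]
  simp_rw [e1] at hx
  refine hx.trans ?_
  refine mul_le_mul (le_abs_self C) (Real.sqrt_le_sqrt e2) (Real.sqrt_nonneg _) (abs_nonneg _)

/-- restriction to one value of a coordinate -/
lemma coord (c : MultiIndex → ℂ) (i : ℕ+) (k : ℕ)
    (hs : ∀ w : ℕ+ →₀ ℂ, Summable fun η : MultiIndex => c η * ∏ j ∈ η.support, w j ^ η j)
    (h0 : ∀ w : ℕ+ →₀ ℂ, ∑' η : MultiIndex, c η * ∏ j ∈ η.support, w j ^ η j = 0)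
    (w : ℕ+ →₀ ℂ) :
    HasSum (fun η : MultiIndex => (if η i = k then c η else 0) * ∏ j ∈ η.support, w j ^ η j) 0 := by
  classical
  set g : MultiIndex → ℂ := fun η => c η * ∏ j ∈ η.support.erase i, w j ^ η j with hg
  have hprod : ∀ (t : ℂ) (η : MultiIndex), c η * ∏ j ∈ η.support, (w.update i t) j ^ η j = g η * t ^ η i := by
    intro t η
    have e1 : ∏ j ∈ η.support.erase i, (w.update i t) j ^ η j = ∏ j ∈ η.support.erase i, w j ^ η j :=
      Finset.prod_congr rfl fun j hj => by
        rw [Finsupp.update_apply, if_neg (Finset.ne_of_mem_erase hj)]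
    by_cases hi : i ∈ η.support
    · rw [← Finset.prod_erase_mul _ _ hi, e1, Finsupp.update_apply, if_pos rfl, mul_assoc]
    · rw [Finsupp.notMem_support_iff.1 hi, pow_zero, mul_one, ← Finset.erase_eq_of_notMem hi, e1,
        Finset.erase_eq_of_notMem hi, hg]
      simp only [Finset.erase_eq_of_notMem hi]
  have hS : ∀ t : ℂ, HasSum (fun η : MultiIndex => g η * t ^ η i) 0 := by
    intro t
    have := (hs (w.update i t)).hasSum
    rw [h0] at this
    simpa only [hprod] using this
  have hfib : ∀ m, Summable (fun η : {η : MultiIndex // η i = m} => g η) := by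
    intro m
    have := (hS 1).summable
    simp only [one_pow, mul_one] at this
    exact this.subtype {η : MultiIndex | η i = m}
  set a : ℕ → ℂ := fun m => ∑' η : {η : MultiIndex // η i = m}, g η with ha
  have hpow : ∀ t : ℂ, HasSum (fun m => t ^ m * a m) 0 := by
    intro t
    have h1 := (Equiv.sigmaFiberEquiv (fun η : MultiIndex => η i)).hasSum_iff.2 (hS t)
    have h2 := h1.sigma (g := fun m => t ^ m * a m) (fun m => by
      have := (hfib m).hasSum.mul_left (t ^ m)
      refine Eq.mpr (congrArg (fun f => HasSum f _) (funext ?_)) this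
      rintro ⟨η, hη⟩
      simp [Equiv.sigmaFiberEquiv, hη, mul_comm])
    exact h2
  have hak : a k = 0 := by
    have hp : HasFPowerSeriesAt (fun _ : ℂ => (0:ℂ)) (FormalMultilinearSeries.ofScalars ℂ a) 0 := by
      rw [hasFPowerSeriesAt_iff]
      refine Filter.Eventually.of_forall fun t => ?_
      simpa using hpow t
    have := hp.eq_zero
    have h2 : (FormalMultilinearSeries.ofScalars ℂ a).coeff k = 0 := by rw [this]; rfl
    simpa using h2
  have hfin : HasSum (fun η : {η : MultiIndex // η i = k} => g η * (w i) ^ k) 0 := by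
    have := (hfib k).hasSum.mul_right (w i ^ k)
    rw [show ∑' η : {η : MultiIndex // η i = k}, g η = 0 from hak, zero_mul] at this
    exact this
  have := (hasSum_subtype_iff_indicator (f := fun η : MultiIndex => g η * (w i) ^ k)
    (s := {η : MultiIndex | η i = k})).1 hfin
  refine Eq.mpr (congrArg (fun f => HasSum f _) (funext ?_)) this
  intro η
  by_cases hη : η i = k
  · rw [Set.indicator_of_mem (by exact hη), if_pos hη]
    have := hprod (w i) η
    rw [hη] at this
    rw [← this]
    simp
  · rw [Set.indicator_of_notMem (by exact hη), if_neg hη, zero_mul]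

lemma coeff_zero (c : MultiIndex → ℂ)
    (hs : ∀ w : ℕ+ →₀ ℂ, Summable fun η : MultiIndex => c η * ∏ j ∈ η.support, w j ^ η j)
    (h0 : ∀ w : ℕ+ →₀ ℂ, ∑' η : MultiIndex, c η * ∏ j ∈ η.support, w j ^ η j = 0)
    (κ : MultiIndex) : c κ = 0 := by
  classical
  have main : ∀ (s : Finset ℕ+) (w : ℕ+ →₀ ℂ), HasSum (fun η : MultiIndex =>
      (if ∀ i ∈ s, η i = κ i then c η else 0) * ∏ j ∈ η.support, w j ^ η j) 0 := by
    intro s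
    induction s using Finset.induction_on with
    | empty => 
      intro w
      have := (hs w).hasSum
      rw [h0] at this
      simpa using this
    | insert i s his ih =>
      intro w
      have := coord _ i (κ i) (fun w => (ih w).summable) (fun w => (ih w).tsum_eq) w
      refine Eq.mpr (congrArg (fun f => HasSum f _) (funext ?_)) this
      intro η
      congr 1
      by_cases h : η i = κ i <;> simp [h]
  set w : ℕ+ →₀ ℂ := Finsupp.onFinset κ.support (fun i => if i ∈ κ.support then 1 else 0)
    (fun i h => by by_contra hc; simp [hc] at h) with hw
  have h := main κ.support w
  have h' : HasSum (fun η : MultiIndex =>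
      (if ∀ i ∈ κ.support, η i = κ i then c η else 0) * ∏ j ∈ η.support, w j ^ η j) (c κ) := by
    have hsingle := hasSum_ite_eq κ (c κ)
    refine Eq.mpr (congrArg (fun f => HasSum f _) (funext ?_)) hsingle
    intro η
    by_cases hη : η = κ
    · subst hη
      rw [if_pos rfl, if_pos (fun i _ => rfl), Finset.prod_eq_one, mul_one]
      intro j hj
      simp only [hw, Finsupp.onFinset_apply, if_pos hj, one_pow]
    · rw [if_neg hη]
      by_cases hc : ∀ i ∈ κ.support, η i = κ i
      · have : ∃ j ∈ η.support, j ∉ κ.support := by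
          by_contra hcon
          push Not at hcon
          apply hη
          ext j
          by_cases hj : j ∈ κ.support
          · exact hc j hj
          · have h2 : j ∉ η.support := fun h => hj (hcon j h)
            rw [Finsupp.notMem_support_iff.1 hj, Finsupp.notMem_support_iff.1 h2]
        obtain ⟨j, hj, hj'⟩ := this
        rw [Finset.prod_eq_zero hj, mul_zero]
        simp only [hw, Finsupp.onFinset_apply, if_neg hj']
        exact zero_pow (Finsupp.mem_support_iff.1 hj)
      · rw [if_neg hc, zero_mul]
  exact h'.unique h

lemma abel_dini (a : ℕ → ℝ) (ha : ∀ n, 0 ≤ a n) (hs : ¬ Summable a) :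
    ∃ b : ℕ → ℝ, (∀ n, 0 ≤ b n) ∧ (Summable fun n => b n ^ 2 * a n) ∧
      ¬ Summable fun n => b n * a n := by
  set S : ℕ → ℝ := fun n => 1 + ∑ i ∈ Finset.range n, a i with hS
  have hS1 : ∀ n, 1 ≤ S n := fun n => by
    have : 0 ≤ ∑ i ∈ Finset.range n, a i := Finset.sum_nonneg fun i _ => ha i
    simp only [hS]; linarith
  have hSs : ∀ n, S (n + 1) = S n + a n := fun n => by simp only [hS, Finset.sum_range_succ]; ring
  have hpos : ∀ n, 0 < S n := fun n => by linarith [hS1 n]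
  have htend : Filter.Tendsto S Filter.atTop Filter.atTop :=
    Filter.tendsto_atTop_add_const_left _ _ ((not_summable_iff_tendsto_nat_atTop_of_nonneg ha).1 hs)
  have hmono : Monotone S := monotone_nat_of_le_succ fun n => by rw [hSs]; linarith [ha n]
  refine ⟨fun n => 1 / S (n + 1), fun n => (one_div_pos.2 (hpos _)).le, ?_, ?_⟩
  · refine summable_of_sum_range_le (c := 1) (fun n => mul_nonneg (sq_nonneg _) (ha n)) fun n => ?_
    have : ∀ n, ∑ i ∈ Finset.range n, (1 / S (i + 1)) ^ 2 * a i ≤ 1 - 1 / S n := by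
      intro n
      induction n with
      | zero => simp [hS]
      | succ n ih =>
        rw [Finset.sum_range_succ]
        have h1 : (1 / S (n + 1)) ^ 2 * a n ≤ 1 / S n - 1 / S (n + 1) := by
          have e : a n = S (n + 1) - S n := by rw [hSs]; ring
          have p1 := hpos n
          have p2 := hpos (n + 1)
          have hle : S n ≤ S (n+1) := hmono (Nat.le_succ n)
          rw [e, div_sub_div _ _ p1.ne' p2.ne', div_pow, one_pow, one_div_mul_eq_div,
            div_le_div_iff₀ (by positivity) (by positivity)]
          have : 0 ≤ (S (n+1) - S n) * S (n+1) * (S (n+1) - S n) := by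
            have : 0 ≤ S (n+1) - S n := by linarith
            positivity
          nlinarith
        linarith
    have h2 : 0 ≤ 1 / S n := (one_div_pos.2 (hpos _)).le
    linarith [this n]
  · intro hsum
    have hc := hsum.tendsto_sum_tsum_nat
    have htail : ∀ p q, p ≤ q → (S q - S p) / S q ≤ ∑ i ∈ Finset.Ico p q, 1 / S (i + 1) * a i := by
      intro p q hpq
      have : S q - S p = ∑ i ∈ Finset.Ico p q, a i := by
        rw [Finset.sum_Ico_eq_sub _ hpq]; simp only [hS]; ring
      rw [this, Finset.sum_div]
      refine Finset.sum_le_sum fun i hi => ?_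
      rw [one_div_mul_eq_div]
      have hle : S (i + 1) ≤ S q := hmono (by have := (Finset.mem_Ico.1 hi).2; omega)
      exact div_le_div_of_nonneg_left (ha i) (hpos _) hle
    obtain ⟨p, hp⟩ := Metric.cauchySeq_iff'.1 hc.cauchySeq (1/2) (by norm_num)
    obtain ⟨q, hq, hpq⟩ := ((htend.eventually_ge_atTop (2 * S p)).and
      (Filter.eventually_ge_atTop p)).exists
    have h1 := hp q hpq
    rw [Real.dist_eq, ← Finset.sum_Ico_eq_sub _ hpq] at h1
    have h2 := htail p q hpq
    have h3 : 1 / 2 ≤ (S q - S p) / S q := by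
      rw [div_le_div_iff₀ (by norm_num) (hpos q)]; linarith
    linarith [le_abs_self (∑ i ∈ Finset.Ico p q, 1 / S (i + 1) * a i)]

end S4
namespace S4
open Finset

lemma sum_sq_summable {f g : ℕ+ → ℝ} (hf : Summable fun i => f i ^ 2) (hg : Summable fun i => g i ^ 2) :
    Summable fun i => (f i + g i) ^ 2 := by
  refine Summable.of_nonneg_of_le (fun i => sq_nonneg _) (fun i => ?_) ((hf.add hg).mul_left 2)
  nlinarith [sq_nonneg (f i - g i)]

lemma exists_dir (ωm : ℕ+ → ℂ) (h2 : ¬ Summable fun i : ℕ+ => ‖ωm i‖ ^ 2) :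
    ∃ (ζ : ℕ+ → ℂ), (Summable fun i => ‖ζ i‖ ^ 2) ∧
      ∀ (n : ℕ) (K : ℝ), ∃ t : Finset ℕ+, (∀ i ∈ t, n ≤ i.natPred) ∧
        K ≤ ∑ i ∈ t, (-ωm i * ζ i).re := by
  have hs : ¬ Summable (fun n : ℕ => ‖ωm n.succPNat‖ ^ 2) := by
    intro h
    exact h2 ((Equiv.pnatEquivNat.symm.summable_iff (f := fun i => ‖ωm i‖ ^ 2)).1 h)
  obtain ⟨b, hb0, hb1, hb2⟩ := abel_dini _ (fun n => sq_nonneg _) hs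
  refine ⟨fun i => -((b i.natPred : ℂ) * (starRingEnd ℂ) (ωm i)), ?_, ?_⟩
  · refine (Equiv.pnatEquivNat.symm.summable_iff).1 ?_
    refine Eq.mpr (congrArg (fun f => Summable f) (funext ?_)) hb1
    intro n
    simp [Equiv.pnatEquivNat, mul_pow]
  · intro n K
    have hre : ∀ i : ℕ+, (-ωm i * -((b i.natPred : ℂ) * (starRingEnd ℂ) (ωm i))).re
        = b i.natPred * ‖ωm i‖ ^ 2 := by
      intro i
      have : -ωm i * -((b i.natPred : ℂ) * (starRingEnd ℂ) (ωm i))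
          = ((b i.natPred * ‖ωm i‖ ^ 2 : ℝ) : ℂ) := by
        push_cast
        rw [← Complex.mul_conj']; ring
      rw [this, Complex.ofReal_re]
    have ht := (not_summable_iff_tendsto_nat_atTop_of_nonneg
      (fun n => mul_nonneg (hb0 n) (sq_nonneg _))).1 hb2
    obtain ⟨M, hM, hnM⟩ := ((ht.eventually_ge_atTop
      (K + ∑ i ∈ Finset.range n, b i * ‖ωm i.succPNat‖ ^ 2)).and
      (Filter.eventually_ge_atTop n)).exists
    refine ⟨(Finset.Ico n M).image Nat.succPNat, ?_, ?_⟩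
    · intro i hi
      obtain ⟨m, hm, rfl⟩ := Finset.mem_image.1 hi
      simpa using (Finset.mem_Ico.1 hm).1
    · rw [Finset.sum_image (fun a _ b _ h => Nat.succPNat_injective h)]
      simp only [hre]
      simp only [Nat.natPred_succPNat]
      rw [Finset.sum_Ico_eq_sub _ hnM]
      linarith

lemma vanish (ωp ωm : ℕ+ → ℂ)
    (h1 : Summable fun i : ℕ+ => ‖ωp i‖ ^ 2)
    (h2 : ¬ Summable fun i : ℕ+ => ‖ωm i‖ ^ 2)
    (Φ : MultiIndex → ℂ) (hΦ : Memℓp Φ 2) (C : ℝ)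
    (hC : ∀ f : MultiIndex →₀ ℂ,
      ‖∑' η : MultiIndex, (starRingEnd ℂ) (Φ η) * ∑ ν ∈ f.support, f ν * vElem ωp ωm η ν‖ ≤
        C * Real.sqrt (∑ ν ∈ f.support, ‖f ν‖ ^ 2))
    (w : ℕ+ →₀ ℂ) :
    ∑' η : MultiIndex, (starRingEnd ℂ) (Φ η) * coh w η = 0 := by
  classical
  obtain ⟨ζ, hζ, hdir⟩ := exists_dir ωm h2
  set s1 : ℕ → Finset ℕ+ := fun n => w.support ∪ (Finset.range n).image Nat.succPNat with hs1
  set q : ℕ → ℕ+ → ℂ := fun n i => w i - (if i.natPred < n then ωp i else 0) with hq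
  have hq0 : ∀ n i, i ∉ s1 n → q n i = 0 := by
    intro n i hi
    simp only [hs1, Finset.mem_union, not_or, Finsupp.mem_support_iff, not_not] at hi
    have : ¬ i.natPred < n := fun h => hi.2 (Finset.mem_image.2 ⟨i.natPred, Finset.mem_range.2 h, by simp⟩)
    simp [hq, hi.1, this]
  choose t ht1 ht2 using fun n : ℕ => hdir n (n - ∑ i ∈ s1 n, (-ωm i * q n i).re)
  set z : ℕ → ℕ+ → ℂ := fun n i => q n i + (if i ∈ t n then ζ i else 0) with hz
  have hz0 : ∀ n i, i ∉ s1 n ∪ t n → z n i = 0 := by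
    intro n i hi
    rw [Finset.mem_union, not_or] at hi
    simp [hz, hq0 n i hi.1, hi.2]
  set W : ℕ+ → ℝ := fun i => ‖w i‖ + (‖ωp i‖ + (‖ωp i‖ + ‖ζ i‖)) with hW
  have hWs : Summable fun i => W i ^ 2 := by
    refine sum_sq_summable ?_ (sum_sq_summable h1 (sum_sq_summable h1 hζ))
    exact summable_of_ne_finset_zero (s := w.support) (fun i hi => by
      rw [Finsupp.notMem_support_iff.1 hi]; simp)
  have hzn : ∀ n i, ‖z n i‖ ≤ ‖w i‖ + (‖ωp i‖ + ‖ζ i‖) := by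
    intro n i
    have e1 : ‖q n i‖ ≤ ‖w i‖ + ‖ωp i‖ := by
      refine (norm_sub_le _ _).trans ?_
      gcongr
      split_ifs <;> simp
    have e2 : ‖(if i ∈ t n then ζ i else 0)‖ ≤ ‖ζ i‖ := by
      split_ifs <;> simp
    have := norm_add_le (q n i) (if i ∈ t n then ζ i else 0)
    simp only [hz]; linarith
  have hzW : ∀ n i, ‖z n i‖ ≤ W i := fun n i => by
    have := hzn n i
    have := norm_nonneg (ωp i)
    simp only [hW]; linarith
  have hxW : ∀ n i, ‖ωp i + z n i‖ ≤ W i := fun n i => by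
    have := hzn n i
    have := norm_add_le (ωp i) (z n i)
    simp only [hW]; linarith
  set D := |C| * Real.sqrt (Real.exp (∑' i, W i ^ 2)) with hD
  have hbound : ∀ n : ℕ, ‖∑' η : MultiIndex, (starRingEnd ℂ) (Φ η) * coh (fun i => ωp i + z n i) η‖
      ≤ D * Real.exp (-n) := by
    intro n
    have hk := key_bound ωp ωm h1 Φ hΦ C hC (z n) (s1 n ∪ t n) (hz0 n)
    have hzz : Summable fun i => ‖z n i‖ ^ 2 :=
      summable_of_ne_finset_zero (s := s1 n ∪ t n) (fun i hi => by simp [hz0 n i hi])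
    have hle : ∑' i, ‖z n i‖ ^ 2 ≤ ∑' i, W i ^ 2 :=
      hzz.tsum_le_tsum (fun i => pow_le_pow_left₀ (norm_nonneg _) (hzW n i) 2) hWs
    have hk2 := hk.trans (mul_le_mul_of_nonneg_left
      (Real.sqrt_le_sqrt (Real.exp_le_exp.2 hle)) (abs_nonneg C))
    rw [norm_mul] at hk2
    have hA : Real.exp n ≤ ‖∏ i ∈ s1 n ∪ t n, NormedSpace.exp (-ωm i * z n i)‖ := by
      rw [← Complex.exp_eq_exp_ℂ, ← Complex.exp_sum, Complex.norm_exp]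
      refine Real.exp_le_exp.2 ?_
      rw [Complex.re_sum]
      have e0 : ∀ i, (-ωm i * z n i).re = (-ωm i * q n i).re +
          (if i ∈ t n then (-ωm i * ζ i).re else 0) := by
        intro i
        simp only [hz, mul_add, Complex.add_re]
        split_ifs <;> simp
      simp_rw [e0]
      rw [Finset.sum_add_distrib]
      have e1 : ∑ i ∈ s1 n ∪ t n, (-ωm i * q n i).re = ∑ i ∈ s1 n, (-ωm i * q n i).re := by
        refine (Finset.sum_subset Finset.subset_union_left fun i _ hi => ?_).symm
        rw [hq0 n i hi]; simp
      have e2 : ∑ i ∈ s1 n ∪ t n, (if i ∈ t n then (-ωm i * ζ i).re else 0)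
          = ∑ i ∈ t n, (-ωm i * ζ i).re := by
        rw [← Finset.sum_subset (Finset.subset_union_right (s₁ := s1 n))
          (fun i _ hi => if_neg hi)]
        exact Finset.sum_congr rfl fun i hi => if_pos hi
      rw [e1, e2]
      linarith [ht2 n]
    have hk3 := (mul_le_mul_of_nonneg_right hA (norm_nonneg _)).trans hk2
    rw [Real.exp_neg, ← div_eq_mul_inv, le_div_iff₀ (Real.exp_pos _), mul_comm]
    exact hk3
  have hto0 : Filter.Tendsto (fun n : ℕ => ∑' η : MultiIndex, (starRingEnd ℂ) (Φ η) *
      coh (fun i => ωp i + z n i) η) Filter.atTop (nhds 0) := by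
    refine squeeze_zero_norm hbound ?_
    have : Filter.Tendsto (fun n : ℕ => Real.exp (-(n:ℝ))) Filter.atTop (nhds 0) :=
      Real.tendsto_exp_neg_atTop_nhds_zero.comp tendsto_natCast_atTop_atTop
    simpa using this.const_mul D
  have htow : Filter.Tendsto (fun n : ℕ => ∑' η : MultiIndex, (starRingEnd ℂ) (Φ η) *
      coh (fun i => ωp i + z n i) η) Filter.atTop
      (nhds (∑' η : MultiIndex, (starRingEnd ℂ) (Φ η) * coh w η)) := by
    refine tendsto_tsum_of_dominated_convergence (dom_summable hΦ hWs) ?_ ?_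
    · intro η
      refine Filter.Tendsto.const_mul _ ?_
      unfold coh
      refine Filter.Tendsto.mul_const _ ?_
      refine tendsto_finsetProd _ fun i _ => ?_
      refine Filter.Tendsto.pow ?_ _
      refine tendsto_const_nhds.congr' ?_
      filter_upwards [Filter.eventually_gt_atTop i.natPred] with n hn
      have : i ∉ t n := fun h => by have := ht1 n i h; omega
      simp [hz, hq, hn, this]
    · refine Filter.Eventually.of_forall fun n η => ?_
      rw [norm_mul, RCLike.norm_conj, norm_coh]
      exact mul_le_mul_of_nonneg_left (coh_mono (fun i => norm_nonneg _) (hxW n) η) (norm_nonneg _)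
  exact tendsto_nhds_unique htow hto0

end S4

/-- If `∑|ω_i|² < ∞` but `∑|ω_{−i}|² = ∞`, then the adjoint of the minimal vertex operator
`V(ω)₀` (defined on the span of the basis vectors by `V(ω)₀ e_ν = ∑_η v_{η,ν}(ω) e_η`) has
domain `{0}`: no nonzero `Φ ∈ ℓ²` admits a constant `C` with
`|⟨Φ, V(ω)₀ f⟩| ≤ C‖f‖` for all `f` in the span.  In particular `V(ω)₀` (and every
extension of it) is not closable. -/
theorem stmt4 (ωp ωm : ℕ+ → ℂ)
    (h1 : Summable fun i : ℕ+ => ‖ωp i‖ ^ 2)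
    (h2 : ¬ Summable fun i : ℕ+ => ‖ωm i‖ ^ 2)
    (Φ : MultiIndex → ℂ) (hΦ : Memℓp Φ 2) (hne : Φ ≠ 0) :
    ¬ ∃ C : ℝ, ∀ f : MultiIndex →₀ ℂ,
      ‖∑' η : MultiIndex, (starRingEnd ℂ) (Φ η) * ∑ ν ∈ f.support, f ν * vElem ωp ωm η ν‖ ≤
        C * Real.sqrt (∑ ν ∈ f.support, ‖f ν‖ ^ 2) := by
  rintro ⟨C, hC⟩
  apply hne
  funext κ
  have hv := S4.vanish ωp ωm h1 h2 Φ hΦ C hC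
  have e : ∀ (w : ℕ+ →₀ ℂ) (η : MultiIndex), (starRingEnd ℂ) (Φ η) * S4.coh w η =
      ((starRingEnd ℂ) (Φ η) * ((1 / Real.sqrt (miFact η : ℝ) : ℝ) : ℂ)) *
        ∏ j ∈ η.support, w j ^ η j := by
    intro w η
    unfold S4.coh
    simp only [Complex.coe_algebraMap]
    ring
  have hsm : ∀ w : ℕ+ →₀ ℂ, Summable fun η : MultiIndex => (starRingEnd ℂ) (Φ η) * S4.coh w η := by
    intro w
    have hw : Summable fun i => ‖w i‖ ^ 2 :=
      summable_of_ne_finset_zero (s := w.support) (fun i hi => by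
        rw [Finsupp.notMem_support_iff.1 hi]; simp)
    refine Summable.of_norm_bounded (S4.dom_summable hΦ hw) fun η => ?_
    rw [norm_mul, RCLike.norm_conj, S4.norm_coh]
  simp only [e] at hv hsm
  have := S4.coeff_zero _ hsm hv κ
  rcases mul_eq_zero.1 this with h | h
  · simpa using h
  · exfalso
    have h0 : (1 / Real.sqrt (miFact κ : ℝ)) = 0 := by exact_mod_cast h
    have hp : (0:ℝ) < Real.sqrt (miFact κ : ℝ) :=
      Real.sqrt_pos.2 (by exact_mod_cast S4.miFact_pos κ)
    have : 0 < 1 / Real.sqrt (miFact κ : ℝ) := by positivity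
    linarith
end

section
/- Assume ∑_{i≥1}|ω_{−i}|² < ∞ and ∑_{i≥1}|ω_i|² = ∞. Then the maximal domain of the vertex operator V(ω) is trivial: if Ψ ∈ H is such that (a) for every multi-index η the limit L_η := lim_{k→∞} ∑_{ν : ‖ν‖ ≤ k} v_{η,ν}(ω)·⟨e_ν, Ψ⟩ exists, and (b) ∑_η |L_η|² < ∞, then Ψ = 0. -/
/-- The weight `‖η‖ = ∑_{i≥1} i·η_i` of a multi-index. -/
def miWt (η : MultiIndex) : ℕ := ∑ i ∈ η.support, (i : ℕ) * η i

open Finset Filter Topology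

namespace VO

theorem oneD {𝕜 : Type*} [RCLike 𝕜] (z x y : 𝕜) (m : ℕ) :
    HasSum (fun n : ℕ => z ^ n / (n.factorial : 𝕜) * mPoly n m x y)
      (NormedSpace.exp (x * z) * (z + y) ^ m) := by
  have key : ∀ j : ℕ, HasSum (fun n : ℕ => z ^ n / (n.factorial : 𝕜) *
      ((n.choose j : 𝕜) * (m.choose j : 𝕜) * (Nat.factorial j : 𝕜) * x ^ (n - j) * y ^ (m - j)))
      (NormedSpace.exp (x * z) * (z ^ j * y ^ (m - j) * (m.choose j : 𝕜))) := by
    intro j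
    have h0 := (NormedSpace.expSeries_div_hasSum_exp (x * z)).mul_right
      (z ^ j * y ^ (m - j) * (m.choose j : 𝕜))
    refine (hasSum_iff_hasSum_of_ne_zero_bij (fun k => (k : ℕ) + j) ?_ ?_ ?_).2 h0
    · intro a b hab
      exact Subtype.ext (by simpa using hab)
    · intro n hn
      have hjn : j ≤ n := by
        by_contra hlt
        apply hn
        simp [Nat.choose_eq_zero_of_lt (not_le.1 hlt)]
      have hfac : ((n.factorial : 𝕜)) = (n.choose j : 𝕜) * (j.factorial : 𝕜) * ((n-j).factorial : 𝕜) := by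
        rw [← Nat.choose_mul_factorial_mul_factorial hjn]; push_cast; ring
      refine ⟨⟨n - j, ?_⟩, by simp [hjn]⟩
      intro h
      apply hn
      have h1 : ((n-j).factorial : 𝕜) ≠ 0 := by exact_mod_cast (n-j).factorial_ne_zero
      have h2 : (x * z) ^ (n-j) * (z ^ j * y ^ (m - j) * (m.choose j : 𝕜)) = 0 := by
        simp only [] at h
        rw [div_mul_eq_mul_div, div_eq_zero_iff] at h
        exact h.resolve_right h1
      have hz : z ^ n = z ^ (n-j) * z ^ j := by rw [← pow_add]; congr 1; omega
      have : z ^ n * ((n.choose j : 𝕜) * (m.choose j : 𝕜) * (Nat.factorial j : 𝕜) * x ^ (n - j) * y ^ (m - j))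
        = (n.choose j : 𝕜) * (Nat.factorial j : 𝕜) * ((x * z) ^ (n-j) * (z ^ j * y ^ (m - j) * (m.choose j : 𝕜))) := by
        rw [hz, mul_pow]; ring
      simp only []
      rw [div_mul_eq_mul_div, this, h2]; simp
    · rintro ⟨k, hk⟩
      have hfac : (((k+j).factorial : 𝕜)) = ((k+j).choose j : 𝕜) * (j.factorial : 𝕜) * (k.factorial : 𝕜) := by
        have := Nat.choose_mul_factorial_mul_factorial (Nat.le_add_left j k)
        rw [← this]; simp
      have h1 : (k.factorial : 𝕜) ≠ 0 := by exact_mod_cast k.factorial_ne_zero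
      have h3 : (j.factorial : 𝕜) ≠ 0 := by exact_mod_cast j.factorial_ne_zero
      have h2 : ((k+j).choose j : 𝕜) ≠ 0 := by
        exact_mod_cast (Nat.choose_pos (Nat.le_add_left j k)).ne'
      simp only [Nat.add_sub_cancel]
      rw [hfac, mul_pow, pow_add]
      field_simp
  have hs := hasSum_sum (s := Finset.range (m+1)) (fun j _ => key j)
  convert hs using 1
  · funext n
    rw [← Finset.mul_sum]
    congr 1
    unfold mPoly
    refine Finset.sum_subset ?_ ?_
    · intro j; simp only [Finset.mem_range]; omega
    · intro j hj hj'
      simp only [Finset.mem_range] at hj hj'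
      have : n < j := by omega
      simp [Nat.choose_eq_zero_of_lt this]
  · rw [← Finset.mul_sum, add_pow]

/-- finite product of sums -/
theorem prodSum {𝕜 : Type*} [RCLike 𝕜] (f : ℕ+ → ℕ → 𝕜) (s : ℕ+ → 𝕜)
    (h : ∀ i, HasSum (f i) (s i)) (S : Finset ℕ+) :
    HasSum (fun η : MultiIndex => if η.support ⊆ S then ∏ i ∈ S, f i (η i) else 0)
      (∏ i ∈ S, s i) := by
  induction S using Finset.induction_on with
  | empty =>
    have : (fun η : MultiIndex => if η.support ⊆ (∅ : Finset ℕ+) then ∏ i ∈ (∅ : Finset ℕ+), f i (η i) else 0)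
      = fun η => if η = 0 then (1:𝕜) else 0 := by
      funext η; simp [Finset.subset_empty]
    rw [this]
    simpa using hasSum_ite_eq (0 : MultiIndex) (1:𝕜)
  | insert a S ha ih =>
    rw [Finset.prod_insert ha, mul_comm]
    have hsm := summable_mul_of_summable_norm (R := 𝕜) ih.summable.norm (h a).summable.norm
    have hm := HasSum.mul (α := 𝕜) ih (h a) hsm
    have hz : ∀ p : MultiIndex × ℕ, p ∈ Function.support (fun x : MultiIndex × ℕ =>
        (if x.1.support ⊆ S then ∏ i ∈ S, f i (x.1 i) else 0) * f a x.2) → p.1.support ⊆ S := by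
      intro p hp
      by_contra hc
      apply hp
      simp [hc]
    refine (hasSum_iff_hasSum_of_ne_zero_bij (fun p => p.1.1.update a p.1.2) ?_ ?_ ?_).2 hm
    · rintro ⟨⟨p, n⟩, hp⟩ ⟨⟨q, k⟩, hq⟩ hpq
      have hp' := hz _ hp
      have hq' := hz _ hq
      simp only at hp' hq' hpq
      have hpa : p a = 0 := Finsupp.notMem_support_iff.1 (fun hh => ha (hp' hh))
      have hqa : q a = 0 := Finsupp.notMem_support_iff.1 (fun hh => ha (hq' hh))
      have hnk : n = k := by simpa using DFunLike.congr_fun hpq a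
      have : p = q := by
        ext i
        by_cases hi : i = a
        · subst hi; rw [hpa, hqa]
        · simpa [Finsupp.update, hi, Function.update_of_ne hi] using DFunLike.congr_fun hpq i
      subst hnk this; rfl
    · intro η hη
      have hsub : η.support ⊆ insert a S := by
        by_contra hc
        apply hη
        simp [hc]
      have hsub' : (η.update a 0).support ⊆ S := by
        intro i hi
        rw [Finsupp.mem_support_iff] at hi
        by_cases hia : i = a
        · subst hia; simp at hi
        · have : η i ≠ 0 := by simpa [Function.update_of_ne hia] using hi
          exact (Finset.mem_insert.1 (hsub (Finsupp.mem_support_iff.2 this))).resolve_left hia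
      have hpr : ∏ i ∈ S, f i ((η.update a 0) i) = ∏ i ∈ S, f i (η i) := by
        refine Finset.prod_congr rfl fun i hi => ?_
        have : i ≠ a := fun h => ha (h ▸ hi)
        simp [Function.update_of_ne this]
      refine ⟨⟨(η.update a 0, η a), ?_⟩, ?_⟩
      · simp only [Function.mem_support] at hη ⊢
        rw [if_pos hsub, Finset.prod_insert ha] at hη
        rw [if_pos hsub', hpr, mul_comm]; exact hη
      · ext i
        by_cases hia : i = a
        · subst hia; simp
        · simp [Function.update_of_ne hia]
    · rintro ⟨⟨p, n⟩, hp⟩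
      have hp' := hz _ hp
      simp only at hp' ⊢
      have hsub : (p.update a n).support ⊆ insert a S := by
        intro i hi
        rw [Finsupp.mem_support_iff] at hi
        by_cases hia : i = a
        · simp [hia]
        · have : p i ≠ 0 := by simpa [Function.update_of_ne hia] using hi
          exact Finset.mem_insert_of_mem (hp' (Finsupp.mem_support_iff.2 this))
      rw [if_pos hp', if_pos hsub, Finset.prod_insert ha, mul_comm]
      congr 1
      · refine Finset.prod_congr rfl fun i hi => ?_
        have : i ≠ a := fun h => ha (h ▸ hi)
        simp [Function.update_of_ne this]
      · simp

/-- normalized monomial -/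
noncomputable def mon {𝕜 : Type*} [RCLike 𝕜] (w : ℕ+ → 𝕜) (ν : MultiIndex) : 𝕜 :=
  (∏ i ∈ ν.support, w i ^ ν i) / ((Real.sqrt (miFact ν) : ℝ) : 𝕜)

noncomputable def vg {𝕜 : Type*} [RCLike 𝕜] (x y : ℕ+ → 𝕜) (η ν : MultiIndex) : 𝕜 :=
  ((1 / Real.sqrt ((miFact η : ℝ) * (miFact ν : ℝ)) : ℝ) : 𝕜) *
    ∏ i ∈ η.support ∪ ν.support, mPoly (η i) (ν i) (x i) (y i)

theorem miFact_pos (η : MultiIndex) : 0 < miFact η :=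
  Finset.prod_pos fun _ _ => Nat.factorial_pos _

theorem mon_sub {𝕜 : Type*} [RCLike 𝕜] (w : ℕ+ → 𝕜) (ν : MultiIndex) (S : Finset ℕ+)
    (h : ν.support ⊆ S) :
    mon w ν = (∏ i ∈ S, w i ^ ν i) / ((Real.sqrt (miFact ν) : ℝ) : 𝕜) := by
  unfold mon
  congr 1
  refine Finset.prod_subset h fun i _ hi => ?_
  simp [Finsupp.notMem_support_iff.1 hi]

theorem miFact_sub (ν : MultiIndex) (S : Finset ℕ+) (h : ν.support ⊆ S) :
    miFact ν = ∏ i ∈ S, (ν i).factorial := by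
  unfold miFact
  refine Finset.prod_subset h fun i _ hi => ?_
  simp [Finsupp.notMem_support_iff.1 hi]

theorem mPoly_zero {𝕜 : Type*} [RCLike 𝕜] (x y : 𝕜) : mPoly 0 0 x y = 1 := by
  simp [mPoly]

theorem genTerm {𝕜 : Type*} [RCLike 𝕜] (z x y : ℕ+ → 𝕜) (S : Finset ℕ+)
    (hz : ∀ i ∉ S, z i = 0) (ν η : MultiIndex) :
    mon z η * vg x y η ν = (if η.support ⊆ S ∪ ν.support then ∏ i ∈ S ∪ ν.support,
      (z i ^ (η i) / ((η i).factorial : 𝕜) * mPoly (η i) (ν i) (x i) (y i)) else 0) *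
      (1 / ((Real.sqrt (miFact ν) : ℝ) : 𝕜)) := by
  by_cases hs : η.support ⊆ S ∪ ν.support
  · rw [if_pos hs, mon_sub z η _ hs]
    unfold vg
    have e1 : ∏ i ∈ η.support ∪ ν.support, mPoly (η i) (ν i) (x i) (y i) =
        ∏ i ∈ S ∪ ν.support, mPoly (η i) (ν i) (x i) (y i) := by
      refine Finset.prod_subset (Finset.union_subset hs Finset.subset_union_right) ?_
      intro i _ hi
      rw [Finset.mem_union, not_or, Finsupp.notMem_support_iff, Finsupp.notMem_support_iff] at hi
      rw [hi.1, hi.2, mPoly_zero]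
    rw [e1, Finset.prod_mul_distrib, Finset.prod_div_distrib]
    have e2 : ∏ i ∈ S ∪ ν.support, ((η i).factorial : 𝕜) =
        ((Real.sqrt (miFact η) : ℝ) : 𝕜) * ((Real.sqrt (miFact η) : ℝ) : 𝕜) := by
      rw [← RCLike.ofReal_mul, Real.mul_self_sqrt (Nat.cast_nonneg _), miFact_sub η _ hs]
      push_cast; rfl
    rw [e2, Real.sqrt_mul (Nat.cast_nonneg _)]
    push_cast
    simp only [div_eq_mul_inv, mul_inv, one_mul]
    ring
  · rw [if_neg hs, zero_mul]
    obtain ⟨i, hi, hi'⟩ := Finset.not_subset.1 hs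
    have hiS : i ∉ S := fun h => hi' (Finset.mem_union_left _ h)
    have : mon z η = 0 := by
      unfold mon
      rw [Finset.prod_eq_zero hi]
      · simp
      · rw [hz i hiS]; exact zero_pow (Finsupp.mem_support_iff.1 hi)
    rw [this, zero_mul]

theorem genSum {𝕜 : Type*} [RCLike 𝕜] (z x y : ℕ+ → 𝕜) (S : Finset ℕ+)
    (hz : ∀ i ∉ S, z i = 0) (ν : MultiIndex) :
    HasSum (fun η : MultiIndex => mon z η * vg x y η ν)
      ((∏ i ∈ S, NormedSpace.exp (x i * z i)) * mon (fun i => z i + y i) ν) := by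
  have h := (prodSum (fun i n => z i ^ n / (n.factorial : 𝕜) * mPoly n (ν i) (x i) (y i)) _
    (fun i => oneD (z i) (x i) (y i) (ν i)) (S ∪ ν.support)).mul_right
      (1 / ((Real.sqrt (miFact ν) : ℝ) : 𝕜))
  have goal2 : (∏ i ∈ S, NormedSpace.exp (x i * z i)) * mon (fun i => z i + y i) ν =
      (∏ i ∈ S ∪ ν.support, NormedSpace.exp (x i * z i) * (z i + y i) ^ ν i) *
        (1 / ((Real.sqrt (miFact ν) : ℝ) : 𝕜)) := by
    rw [Finset.prod_mul_distrib, mon_sub _ ν (S ∪ ν.support) Finset.subset_union_right]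
    have : ∏ i ∈ S, NormedSpace.exp (x i * z i) = ∏ i ∈ S ∪ ν.support, NormedSpace.exp (x i * z i) := by
      refine Finset.prod_subset Finset.subset_union_left fun i _ hi => ?_
      rw [hz i hi, mul_zero, NormedSpace.exp_zero]
    rw [this]; ring
  rw [goal2, funext (genTerm z x y S hz ν)]
  exact h

theorem mon_norm (z : ℕ+ → ℂ) (η : MultiIndex) : ‖mon z η‖ = mon (fun i => ‖z i‖) η := by
  unfold mon
  rw [norm_div, norm_prod]
  congr 1
  · exact Finset.prod_congr rfl fun i _ => norm_pow _ _
  · rw [RCLike.norm_ofReal, abs_of_nonneg (Real.sqrt_nonneg _)]; rfl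

theorem mPoly_norm (n m : ℕ) (x y : ℂ) : ‖mPoly n m x y‖ ≤ mPoly n m ‖x‖ ‖y‖ := by
  unfold mPoly
  refine (norm_sum_le _ _).trans (le_of_eq ?_)
  refine Finset.sum_congr rfl fun j _ => ?_
  simp

theorem vg_norm (x y : ℕ+ → ℂ) (η ν : MultiIndex) :
    ‖vg x y η ν‖ ≤ vg (fun i => ‖x i‖) (fun i => ‖y i‖) η ν := by
  unfold vg
  rw [norm_mul, norm_prod, RCLike.norm_ofReal, abs_of_nonneg (by positivity)]
  simp only [RCLike.ofReal_real_eq_id, id]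
  refine mul_le_mul_of_nonneg_left ?_ (by positivity)
  exact Finset.prod_le_prod (fun i _ => norm_nonneg _) fun i _ => mPoly_norm _ _ _ _

theorem mon_sq (w : ℕ+ → ℂ) (hw : Summable fun i => ‖w i‖ ^ 2) (u : Finset MultiIndex) :
    ∑ ν ∈ u, ‖mon w ν‖ ^ 2 ≤ Real.exp (∑' i, ‖w i‖ ^ 2) := by
  set S := u.biUnion Finsupp.support with hS
  have h := prodSum (fun i n => (‖w i‖ ^ 2) ^ n / (n.factorial : ℝ)) _
    (fun i => NormedSpace.expSeries_div_hasSum_exp (‖w i‖ ^ 2)) S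
  have h1 : ∑ ν ∈ u, ‖mon w ν‖ ^ 2 = ∑ ν ∈ u, (if ν.support ⊆ S then
      ∏ i ∈ S, (‖w i‖ ^ 2) ^ ν i / ((ν i).factorial : ℝ) else 0) := by
    refine Finset.sum_congr rfl fun ν hν => ?_
    have hs : ν.support ⊆ S := Finset.subset_biUnion_of_mem Finsupp.support hν
    rw [if_pos hs, mon_norm, mon_sub _ _ _ hs, Finset.prod_div_distrib, div_pow]
    congr 1
    · rw [← Finset.prod_pow]
      exact Finset.prod_congr rfl fun i _ => by rw [← pow_mul, ← pow_mul, mul_comm]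
    · simp only [RCLike.ofReal_real_eq_id, id]
      rw [Real.sq_sqrt (Nat.cast_nonneg _), miFact_sub ν _ hs]; push_cast; rfl
  rw [h1]
  refine (sum_le_hasSum u (fun ν _ => ?_) h).trans ?_
  · split_ifs
    · positivity
    · exact le_rfl
  · simp only [← Real.exp_eq_exp_ℝ]
    rw [← Real.exp_sum]
    exact Real.exp_le_exp.2 (hw.sum_le_tsum _ fun i _ => by positivity)

theorem mon_summable (w : ℕ+ → ℂ) (hw : Summable fun i => ‖w i‖ ^ 2) :
    Summable fun ν => ‖mon w ν‖ ^ 2 :=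
  summable_of_sum_le (fun _ => by positivity) (mon_sq w hw)

theorem mon_tsum_le (w : ℕ+ → ℂ) (hw : Summable fun i => ‖w i‖ ^ 2) :
    ∑' ν, ‖mon w ν‖ ^ 2 ≤ Real.exp (∑' i, ‖w i‖ ^ 2) :=
  Real.tsum_le_of_sum_le (fun _ => by positivity) (mon_sq w hw)

theorem prod_summable (Ψ : MultiIndex → ℂ) (hΨ : Summable fun ν => ‖Ψ ν‖ ^ 2)
    (w : ℕ+ → ℂ) (hw : Summable fun i => ‖w i‖ ^ 2) :
    Summable fun ν => ‖Ψ ν * mon w ν‖ := by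
  refine Summable.of_nonneg_of_le (fun _ => norm_nonneg _) (fun ν => ?_)
    (hΨ.add (mon_summable w hw))
  rw [norm_mul]
  nlinarith [sq_nonneg (‖Ψ ν‖ - ‖mon w ν‖), sq_nonneg (‖Ψ ν‖), sq_nonneg (‖mon w ν‖)]

theorem weak {ι : Type*} (l : Filter ι) (Ψ : MultiIndex → ℂ) (hΨ : Summable fun ν => ‖Ψ ν‖ ^ 2)
    (w : ι → ℕ+ → ℂ) (w0 : ℕ+ → ℂ) (R : ℝ)
    (hw : ∀ n, Summable fun i => ‖w n i‖ ^ 2) (hwR : ∀ n, ∑' i, ‖w n i‖ ^ 2 ≤ R)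
    (hw0 : Summable fun i => ‖w0 i‖ ^ 2) (hw0R : ∑' i, ‖w0 i‖ ^ 2 ≤ R)
    (hlim : ∀ i, Tendsto (fun n => w n i) l (𝓝 (w0 i))) :
    Tendsto (fun n => ∑' ν, Ψ ν * mon (w n) ν) l (𝓝 (∑' ν, Ψ ν * mon w0 ν)) := by
  have tail : ∀ (K : ℝ), 0 < K → ∀ T : Finset MultiIndex, ∀ v : ℕ+ → ℂ,
      (Summable fun i => ‖v i‖ ^ 2) → (∑' i, ‖v i‖ ^ 2 ≤ R) →
      ‖(∑' ν, Ψ ν * mon v ν) - ∑ ν ∈ T, Ψ ν * mon v ν‖ ≤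
        K * (∑' ν : ↑((T : Set MultiIndex)ᶜ), ‖Ψ ν‖ ^ 2) + Real.exp R / K := by
    intro K hK T v hv hvR
    have hs := prod_summable Ψ hΨ v hv
    rw [← hs.of_norm.sum_add_tsum_compl (s := T), add_sub_cancel_left]
    have hs' : Summable fun ν : ↑((T : Set MultiIndex)ᶜ) => ‖Ψ ν * mon v ν‖ :=
      hs.subtype ((T : Set MultiIndex)ᶜ)
    have ha : Summable fun ν : ↑((T : Set MultiIndex)ᶜ) => ‖Ψ ν‖ ^ 2 :=
      hΨ.subtype ((T : Set MultiIndex)ᶜ)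
    have hb : Summable fun ν : ↑((T : Set MultiIndex)ᶜ) => ‖mon v ν‖ ^ 2 :=
      (mon_summable v hv).subtype ((T : Set MultiIndex)ᶜ)
    refine (norm_tsum_le_tsum_norm hs').trans ?_
    have hle : ∑' ν : ↑((T : Set MultiIndex)ᶜ), ‖Ψ ν * mon v ν‖ ≤
        ∑' ν : ↑((T : Set MultiIndex)ᶜ), (K * ‖Ψ ν‖ ^ 2 + ‖mon v ν‖ ^ 2 / K) := by
      refine hs'.tsum_le_tsum (fun ν => ?_) ((ha.mul_left K).add (hb.div_const K))
      rw [norm_mul]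
      have : K * ‖Ψ ν‖ ^ 2 + ‖mon v ν‖ ^ 2 / K - ‖Ψ ν‖ * ‖mon v ν‖
        = ((K * ‖Ψ ν‖ - ‖mon v ν‖) ^ 2 + K * ‖Ψ ν‖ * ‖mon v ν‖) / K := by
        field_simp; ring
      have h2 : 0 ≤ ((K * ‖Ψ ν‖ - ‖mon v ν‖) ^ 2 + K * ‖Ψ ν‖ * ‖mon v ν‖) / K := by positivity
      linarith
    refine hle.trans ?_
    rw [(ha.mul_left K).tsum_add (hb.div_const K), tsum_mul_left, tsum_div_const]
    gcongr
    refine (Summable.tsum_subtype_le (fun ν => ‖mon v ν‖ ^ 2) _ (fun _ => by positivity)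
      (mon_summable v hv)).trans ((mon_tsum_le v hv).trans (Real.exp_le_exp.2 hvR))
  rw [Metric.tendsto_nhds]
  intro ε hε
  set K := 8 * Real.exp R / ε with hK
  have hKpos : 0 < K := by positivity
  have hKe : Real.exp R / K = ε / 8 := by
    rw [hK]; field_simp
  have ht := (tendsto_tsum_compl_atTop_zero (fun ν => ‖Ψ ν‖ ^ 2)).const_mul K
  rw [mul_zero] at ht
  obtain ⟨T, hT⟩ := (ht.eventually (gt_mem_nhds (show (0:ℝ) < ε / 8 by positivity))).exists
  have hfin : Tendsto (fun n => ∑ ν ∈ T, Ψ ν * mon (w n) ν) l (𝓝 (∑ ν ∈ T, Ψ ν * mon w0 ν)) := by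
    refine tendsto_finsetSum _ fun ν _ => Tendsto.const_mul _ ?_
    unfold mon
    refine Tendsto.div_const ?_ _
    exact tendsto_finsetProd _ fun i _ => (hlim i).pow _
  filter_upwards [(Metric.tendsto_nhds.1 hfin) (ε / 2) (by positivity)] with n hn
  have h1 := tail K hKpos T (w n) (hw n) (hwR n)
  have h2 := tail K hKpos T w0 hw0 hw0R
  rw [hKe] at h1 h2
  rw [dist_eq_norm] at hn ⊢
  have hT' : K * (∑' ν : ↑((T : Set MultiIndex)ᶜ), ‖Ψ ν‖ ^ 2) < ε / 8 := hT
  set A := ∑' ν, Ψ ν * mon (w n) ν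
  set B := ∑' ν, Ψ ν * mon w0 ν
  set A' := ∑ ν ∈ T, Ψ ν * mon (w n) ν
  set B' := ∑ ν ∈ T, Ψ ν * mon w0 ν
  have : A - B = (A - A') + (A' - B') - (B - B') := by ring
  rw [this]
  have := norm_sub_le ((A - A') + (A' - B')) (B - B')
  have := norm_add_le (A - A') (A' - B')
  linarith

theorem wt_finite (k : ℕ) : {ν : MultiIndex | miWt ν ≤ k}.Finite := by
  have hS : {i : ℕ+ | (i : ℕ) ≤ k}.Finite := by
    refine Set.Finite.of_finite_image (f := fun i : ℕ+ => (i : ℕ)) ?_ (PNat.coe_injective.injOn)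
    refine (Set.finite_Iic k).subset ?_
    rintro _ ⟨i, hi, rfl⟩
    exact hi
  refine ((Finset.finsupp hS.toFinset (fun _ => Finset.range (k+1))).finite_toSet).subset ?_
  intro ν hν
  have hb : ∀ i ∈ ν.support, (i : ℕ) * ν i ≤ k := fun i hi =>
    (Finset.single_le_sum (f := fun i : ℕ+ => (i : ℕ) * ν i) (fun _ _ => Nat.zero_le _) hi).trans hν
  rw [Finset.mem_coe, Finset.mem_finsupp_iff]
  constructor
  · intro i hi
    have h1 := hb i hi
    have h2 : 0 < ν i := Nat.pos_of_ne_zero (Finsupp.mem_support_iff.1 hi)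
    simp only [Set.Finite.mem_toFinset, Set.mem_ofPred_eq]
    nlinarith [i.pos]
  · intro i hi
    by_cases h0 : ν i = 0
    · simp [h0]
    · have h1 := hb i (Finsupp.mem_support_iff.2 h0)
      simp only [Finset.mem_range]
      nlinarith [i.pos]

noncomputable def A (k : ℕ) : Finset MultiIndex := (wt_finite k).toFinset

theorem mem_A (k : ℕ) (ν : MultiIndex) : ν ∈ A k ↔ miWt ν ≤ k := by simp [A]

theorem A_tendsto : Tendsto A atTop atTop := by
  refine tendsto_atTop_finset_of_monotone ?_ ?_
  · intro a b hab ν hν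
    rw [mem_A] at *
    exact hν.trans hab
  · intro ν
    exact ⟨miWt ν, by rw [mem_A]⟩

theorem tsum_A (f : MultiIndex → ℂ) (k : ℕ) :
    ∑' ν : {ν : MultiIndex // miWt ν ≤ k}, f ν = ∑ ν ∈ A k, f ν := by
  rw [← Finset.tsum_subtype]
  exact (Equiv.tsum_eq (Equiv.subtypeEquivRight (fun ν => (mem_A k ν).symm))
    (fun ν : {ν // ν ∈ A k} => f ν))

theorem keyId (ωp y : ℕ+ → ℂ) (hy : Summable fun i => ‖y i‖ ^ 2)
    (Ψ L : MultiIndex → ℂ) (hΨ : Summable fun ν => ‖Ψ ν‖ ^ 2)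
    (hL : ∀ η : MultiIndex, Tendsto (fun k : ℕ => ∑ ν ∈ A k, vg ωp y η ν * Ψ ν)
      atTop (𝓝 (L η)))
    (z : ℕ+ → ℂ) (S : Finset ℕ+) (hz : ∀ i ∉ S, z i = 0) :
    ∑' η, L η * mon z η =
      Complex.exp (∑ i ∈ S, ωp i * z i) * ∑' ν, Ψ ν * mon (fun i => z i + y i) ν := by
  have hzy : Summable fun i => ‖((‖z i‖ + ‖y i‖ : ℝ) : ℂ)‖ ^ 2 := by
    have hz2 : Summable fun i => ‖z i‖ ^ 2 :=
      summable_of_ne_finset_zero (s := S) fun i hi => by simp [hz i hi]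
    refine Summable.of_nonneg_of_le (fun _ => by positivity) (fun i => ?_)
      ((hz2.mul_left 2).add (hy.mul_left 2))
    rw [Complex.norm_real, Real.norm_eq_abs, sq_abs]
    nlinarith [sq_nonneg (‖z i‖ - ‖y i‖)]
  -- absolute summability
  have hsum : Summable (Function.uncurry fun (ν η : MultiIndex) => mon z η * vg ωp y η ν * Ψ ν) := by
    have hR := fun ν => (genSum (𝕜 := ℝ) (fun i => ‖z i‖) (fun i => ‖ωp i‖) (fun i => ‖y i‖) S
      (fun i hi => by simp [hz i hi]) ν).mul_right ‖Ψ ν‖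
    have hnn : ∀ η ν, 0 ≤ mon (fun i => ‖z i‖) η * vg (fun i => ‖ωp i‖) (fun i => ‖y i‖) η ν * ‖Ψ ν‖ := by
      intro η ν
      refine mul_nonneg (mul_nonneg ?_ ?_) (norm_nonneg _)
      · rw [← mon_norm]; exact norm_nonneg _
      · exact (norm_nonneg _).trans (vg_norm ωp y η ν)
    have hB : Summable (fun p : MultiIndex × MultiIndex =>
        mon (fun i => ‖z i‖) p.2 * vg (fun i => ‖ωp i‖) (fun i => ‖y i‖) p.2 p.1 * ‖Ψ p.1‖) := by
      rw [summable_prod_of_nonneg (fun p => hnn p.2 p.1)]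
      refine ⟨fun ν => (hR ν).summable, ?_⟩
      simp only [(hR _).tsum_eq]
      have := (prod_summable Ψ hΨ _ hzy).mul_left (∏ i ∈ S, NormedSpace.exp (‖ωp i‖ * ‖z i‖))
      refine this.congr fun ν => ?_
      rw [norm_mul, mon_norm]
      have e : (fun i => ‖((‖z i‖ + ‖y i‖ : ℝ) : ℂ)‖) = fun i => ‖z i‖ + ‖y i‖ := by
        funext i
        rw [Complex.norm_real, Real.norm_eq_abs, abs_of_nonneg (by positivity)]
      rw [e]; ring
    refine Summable.of_norm_bounded hB ?_
    rintro ⟨ν, η⟩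
    simp only [Function.uncurry]
    rw [norm_mul, norm_mul, mon_norm]
    refine mul_le_mul_of_nonneg_right (mul_le_mul_of_nonneg_left (vg_norm _ _ _ _) ?_) (norm_nonneg _)
    rw [← mon_norm]; exact norm_nonneg _
  have hcomm := hsum.tsum_comm
  have hleft : ∀ η, ∑' ν, mon z η * vg ωp y η ν * Ψ ν = L η * mon z η := by
    intro η
    have hs : Summable fun ν => mon z η * vg ωp y η ν * Ψ ν :=
      hsum.comp_injective (i := fun ν => (ν, η)) (fun a b h => (Prod.ext_iff.1 h).1)
    have t1 := hs.hasSum.comp A_tendsto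
    have t2 := (hL η).mul_const (mon z η)
    refine tendsto_nhds_unique t1 (t2.congr fun k => ?_)
    simp only [Function.comp_apply]
    rw [Finset.sum_mul]
    exact Finset.sum_congr rfl fun ν _ => by ring
  have hright : ∀ ν, ∑' η, mon z η * vg ωp y η ν * Ψ ν =
      Complex.exp (∑ i ∈ S, ωp i * z i) * (Ψ ν * mon (fun i => z i + y i) ν) := by
    intro ν
    rw [((genSum z ωp y S hz ν).mul_right (Ψ ν)).tsum_eq, Complex.exp_sum]
    simp only [← Complex.exp_eq_exp_ℂ]
    ring
  simp only [hleft, hright] at hcomm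
  rw [hcomm, tsum_mul_left]

theorem coeff_zero (a : ℕ → ℂ) (h : ∀ t : ℂ, HasSum (fun n => t ^ n * a n) 0) (n : ℕ) : a n = 0 := by
  have hp : HasFPowerSeriesAt (0 : ℂ → ℂ) (FormalMultilinearSeries.ofScalars ℂ a) 0 := by
    rw [hasFPowerSeriesAt_iff]
    refine Filter.Eventually.of_forall fun t => ?_
    simpa [FormalMultilinearSeries.coeff_ofScalars] using h t
  have := hp.eq_zero
  rw [← FormalMultilinearSeries.coeff_ofScalars (𝕜 := ℂ) (p := a) (n := n), this]
  simp [FormalMultilinearSeries.coeff]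

theorem mon_scale (t : ℂ) (w : ℕ+ → ℂ) (ν : MultiIndex) :
    mon (fun i => t ^ (i : ℕ) * w i) ν = t ^ miWt ν * mon w ν := by
  unfold mon miWt
  simp only [mul_pow, Finset.prod_mul_distrib, ← pow_mul, Finset.prod_pow_eq_pow_sum]
  ring

theorem unique (Ψ : MultiIndex → ℂ) (hΨ : Summable fun ν => ‖Ψ ν‖ ^ 2)
    (h : ∀ (S : Finset ℕ+) (w : ℕ+ → ℂ), (∀ i ∉ S, w i = 0) → ∑' ν, Ψ ν * mon w ν = 0) :
    Ψ = 0 := by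
  have step : ∀ (S : Finset ℕ+) (w : ℕ+ → ℂ), (∀ i ∉ S, w i = 0) → ∀ n,
      ∑ ν ∈ (A n).filter (fun ν => miWt ν = n), Ψ ν * mon w ν = 0 := by
    intro S w hw n
    have hn := coeff_zero (fun n => ∑ ν ∈ (A n).filter (fun ν => miWt ν = n), Ψ ν * mon w ν) ?_ n
    · exact hn
    intro t
    have hw' : ∀ i ∉ S, t ^ (i : ℕ) * w i = 0 := fun i hi => by rw [hw i hi, mul_zero]
    have hs := (prod_summable Ψ hΨ (fun i => t ^ (i : ℕ) * w i)
      (summable_of_ne_finset_zero (s := S) fun i hi => by rw [hw' i hi]; simp)).of_norm.hasSum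
    rw [h S _ hw'] at hs
    have hf := hs.tsum_fiberwise miWt
    refine Eq.mp (congrArg (fun g : ℕ → ℂ => HasSum g 0) (funext fun m => ?_)) hf
    symm
    have e : miWt ⁻¹' {m} = (((A m).filter (fun ν => miWt ν = m) : Finset MultiIndex) : Set MultiIndex) := by
      ext ν
      simp only [Set.mem_preimage, Set.mem_singleton_iff, Finset.coe_filter, Set.mem_ofPred_eq, mem_A]
      omega
    rw [e]
    erw [Finset.tsum_subtype ((A m).filter (fun ν => miWt ν = m))
      (fun ν => Ψ ν * mon (fun i : ℕ+ => t ^ (i : ℕ) * w i) ν)]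
    rw [Finset.mul_sum]
    refine Finset.sum_congr rfl fun ν hν => ?_
    rw [mon_scale, (Finset.mem_filter.1 hν).2]; ring
  funext ν0
  set n := miWt ν0 with hn
  set B := (A n).filter (fun ν => miWt ν = n) with hB
  have hP : (∑ ν ∈ B, MvPolynomial.monomial ν (Ψ ν / ((Real.sqrt (miFact ν) : ℝ) : ℂ)) :
      MvPolynomial ℕ+ ℂ) = 0 := by
    refine MvPolynomial.funext fun w => ?_
    rw [map_sum, map_zero]
    set S := B.biUnion Finsupp.support
    have := step S (fun i => if i ∈ S then w i else 0) (fun i hi => by simp [hi]) n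
    rw [← this]
    refine Finset.sum_congr rfl fun ν hν => ?_
    have hs : ν.support ⊆ S := Finset.subset_biUnion_of_mem Finsupp.support hν
    have e : ∏ i ∈ ν.support, (if i ∈ S then w i else 0) ^ ν i = ∏ i ∈ ν.support, w i ^ ν i :=
      Finset.prod_congr rfl fun i hi => by rw [if_pos (hs hi)]
    rw [MvPolynomial.eval_monomial, Finsupp.prod, mon, e]
    simp only [div_eq_mul_inv, RCLike.ofReal_eq_complex_ofReal]
    ring
  have hc := congrArg (MvPolynomial.coeff ν0) hP
  rw [MvPolynomial.coeff_sum] at hc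
  have hmem : ν0 ∈ B := by simp [hB, mem_A, hn]
  simp only [MvPolynomial.coeff_monomial, Finset.sum_ite_eq', hmem, if_true,
    MvPolynomial.coeff_zero] at hc
  have hpos : ((Real.sqrt (miFact ν0) : ℝ) : ℂ) ≠ 0 := by
    have : (0:ℝ) < miFact ν0 := by exact_mod_cast miFact_pos ν0
    exact_mod_cast (Real.sqrt_pos.2 this).ne'
  simpa [hpos] using (div_eq_zero_iff.1 hc).resolve_right hpos

theorem sq_sum_bound (a b : ℕ+ → ℂ) (ha : Summable fun i => ‖a i‖ ^ 2)
    (hb : Summable fun i => ‖b i‖ ^ 2) :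
    (Summable fun i => ‖a i + b i‖ ^ 2) ∧
      ∑' i, ‖a i + b i‖ ^ 2 ≤ 2 * ∑' i, ‖a i‖ ^ 2 + 2 * ∑' i, ‖b i‖ ^ 2 := by
  have hle : ∀ i, ‖a i + b i‖ ^ 2 ≤ 2 * ‖a i‖ ^ 2 + 2 * ‖b i‖ ^ 2 := by
    intro i
    have := norm_add_le (a i) (b i)
    have h2 : ‖a i + b i‖ ^ 2 ≤ (‖a i‖ + ‖b i‖) ^ 2 := pow_le_pow_left₀ (norm_nonneg _) this 2
    nlinarith [sq_nonneg (‖a i‖ - ‖b i‖)]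
  have hs := (ha.mul_left 2).add (hb.mul_left 2)
  have h1 := Summable.of_nonneg_of_le (fun _ => by positivity) hle hs
  refine ⟨h1, (h1.tsum_le_tsum hle hs).trans (le_of_eq ?_)⟩
  rw [(ha.mul_left 2).tsum_add (hb.mul_left 2), tsum_mul_left, tsum_mul_left]

/-- vanishing of the Bargmann transform on `finite + y` -/
theorem vanish (ωp y : ℕ+ → ℂ) (hy : Summable fun i => ‖y i‖ ^ 2)
    (h2 : ¬ Summable fun i : ℕ+ => ‖ωp i‖ ^ 2)
    (Ψ L : MultiIndex → ℂ) (hΨ : Summable fun ν => ‖Ψ ν‖ ^ 2)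
    (hL : ∀ η : MultiIndex, Tendsto (fun k : ℕ => ∑ ν ∈ A k, vg ωp y η ν * Ψ ν)
      atTop (𝓝 (L η)))
    (hL2 : Summable fun η => ‖L η‖ ^ 2)
    (z : ℕ+ → ℂ) (S0 : Finset ℕ+) (hz : ∀ i ∉ S0, z i = 0) :
    ∑' ν, Ψ ν * mon (fun i => z i + y i) ν = 0 := by
  have hz2 : Summable fun i => ‖z i‖ ^ 2 :=
    summable_of_ne_finset_zero (s := S0) fun i hi => by simp [hz i hi]
  set r : Finset ℕ+ → ℝ := fun S => Real.sqrt (∑ i ∈ S, ‖ωp i‖ ^ 2) with hr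
  have hrsq : ∀ S, r S ^ 2 = ∑ i ∈ S, ‖ωp i‖ ^ 2 := fun S =>
    Real.sq_sqrt (Finset.sum_nonneg fun _ _ => by positivity)
  have hrlim : Tendsto r atTop atTop := by
    refine Real.tendsto_sqrt_atTop.comp ?_
    refine tendsto_atTop_atTop_of_monotone ?_ ?_
    · intro S T hST
      exact Finset.sum_le_sum_of_subset_of_nonneg hST fun _ _ _ => by positivity
    · intro b
      by_contra hc
      push Not at hc
      exact h2 (summable_of_sum_le (fun _ => by positivity) fun u => (hc u).le)
  set u : Finset ℕ+ → ℕ+ → ℂ := fun S i =>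
    if i ∈ S then (starRingEnd ℂ) (ωp i) / (r S : ℂ) else 0 with hu
  have husum : ∀ S, Summable fun i => ‖u S i‖ ^ 2 := fun S =>
    summable_of_ne_finset_zero (s := S) fun i hi => by simp [hu, hi]
  have hule : ∀ S, ∑' i, ‖u S i‖ ^ 2 ≤ 1 := by
    intro S
    rw [tsum_eq_sum (s := S) fun i hi => by simp [hu, hi]]
    have : ∑ i ∈ S, ‖u S i‖ ^ 2 = (∑ i ∈ S, ‖ωp i‖ ^ 2) / r S ^ 2 := by
      rw [Finset.sum_div]
      refine Finset.sum_congr rfl fun i hi => ?_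
      simp only [hu, hi, if_true]
      rw [norm_div, div_pow, RCLike.norm_conj, Complex.norm_real, Real.norm_eq_abs, sq_abs]
    rw [this, ← hrsq]
    exact div_self_le_one _
  have hupt : ∀ i, Tendsto (fun S => u S i) atTop (𝓝 0) := by
    intro i
    have hb : Tendsto (fun S => ‖ωp i‖ / r S) atTop (𝓝 0) := hrlim.const_div_atTop _
    refine squeeze_zero_norm (fun S => ?_) hb
    have hr0 : 0 ≤ r S := Real.sqrt_nonneg _
    by_cases hi : i ∈ S
    · simp only [hu, hi, if_true]
      rw [norm_div, RCLike.norm_conj, Complex.norm_real, Real.norm_eq_abs, abs_of_nonneg hr0]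
    · simp only [hu, hi, if_false, norm_zero]
      positivity
  obtain ⟨hzy, hzyle⟩ := sq_sum_bound z y hz2 hy
  -- convergence of F
  set R := 2 * (∑' i, ‖z i + y i‖ ^ 2) + 2 with hR
  have hzy0 : 0 ≤ ∑' i, ‖z i + y i‖ ^ 2 := tsum_nonneg fun _ => by positivity
  have hF := weak atTop Ψ hΨ (fun S i => (z i + y i) + u S i) (fun i => z i + y i) R
    (fun S => (sq_sum_bound _ _ hzy (husum S)).1)
    (fun S => (sq_sum_bound _ _ hzy (husum S)).2.trans (by linarith [hule S]))
    hzy (by linarith)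
    (fun i => by simpa using (hupt i).const_add (z i + y i))
  -- bound of G
  set R' := 2 * (∑' i, ‖z i‖ ^ 2) + 2 with hR'
  set M := (∑' η, ‖L η‖ ^ 2) + Real.exp R' with hM
  have hG : ∀ S, ‖∑' η, L η * mon (fun i => z i + u S i) η‖ ≤ M := by
    intro S
    obtain ⟨hs, hsle⟩ := sq_sum_bound z (u S) hz2 (husum S)
    have hp := prod_summable L hL2 _ hs
    refine (norm_tsum_le_tsum_norm hp).trans ?_
    have hm := mon_summable _ hs
    refine (hp.tsum_le_tsum (fun η => ?_) (hL2.add hm)).trans ?_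
    · rw [norm_mul]
      nlinarith [sq_nonneg (‖L η‖ - ‖mon (fun i => z i + u S i) η‖), sq_nonneg (‖L η‖),
        sq_nonneg (‖mon (fun i => z i + u S i) η‖)]
    · rw [hL2.tsum_add hm]
      have := (mon_tsum_le _ hs).trans (Real.exp_le_exp.2 (show _ ≤ R' by linarith [hule S]))
      linarith
  set c := (∑ i ∈ S0, ωp i * z i).re with hc
  have hbound : ∀ᶠ S in atTop, ‖∑' ν, Ψ ν * mon (fun i => (z i + y i) + u S i) ν‖ ≤
      M * Real.exp (-c) * Real.exp (- r S) := by
    filter_upwards [eventually_ge_atTop S0, hrlim.eventually_gt_atTop 0] with S hS hrS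
    have hk := keyId ωp y hy Ψ L hΨ hL (fun i => z i + u S i) S (fun i hi => by
      have : i ∉ S0 := fun h => hi (hS h)
      simp [hz i this, hu, hi])
    have hsum : ∑ i ∈ S, ωp i * (z i + u S i) = (∑ i ∈ S0, ωp i * z i) + (r S : ℂ) := by
      simp only [mul_add, Finset.sum_add_distrib]
      congr 1
      · exact (Finset.sum_subset hS fun i _ hi => by rw [hz i hi, mul_zero]).symm
      · have : ∑ i ∈ S, ωp i * u S i = ((r S ^ 2 : ℝ) : ℂ) / (r S : ℂ) := by
          rw [hrsq]
          push_cast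
          rw [Finset.sum_div]
          refine Finset.sum_congr rfl fun i hi => ?_
          simp only [hu, hi, if_true]
          rw [← mul_div_assoc, Complex.mul_conj, Complex.normSq_eq_norm_sq]
          push_cast; rfl
        rw [this]
        have : (r S : ℂ) ≠ 0 := by exact_mod_cast hrS.ne'
        push_cast
        field_simp
    have hfe : (fun i => z i + u S i + y i) = fun i => (z i + y i) + u S i := by
      funext i; ring
    have hn := hG S
    rw [hk, hsum, norm_mul, Complex.norm_exp] at hn
    simp only [hfe] at hn
    rw [Complex.add_re, Complex.ofReal_re, ← hc] at hn
    rw [mul_assoc, ← Real.exp_add]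
    have e : -c + -r S = -(c + r S) := by ring
    rw [e, Real.exp_neg, ← div_eq_mul_inv, le_div_iff₀ (Real.exp_pos _), mul_comm]
    exact hn
  have hlim0 : Tendsto (fun S => M * Real.exp (-c) * Real.exp (- r S)) atTop (𝓝 0) := by
    have := (Real.tendsto_exp_neg_atTop_nhds_zero.comp hrlim).const_mul (M * Real.exp (-c))
    simpa using this
  exact tendsto_nhds_unique hF (squeeze_zero_norm' hbound hlim0)

theorem main (ωp y : ℕ+ → ℂ) (hy : Summable fun i => ‖y i‖ ^ 2)
    (h2 : ¬ Summable fun i : ℕ+ => ‖ωp i‖ ^ 2)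
    (Ψ L : MultiIndex → ℂ) (hΨ : Summable fun ν => ‖Ψ ν‖ ^ 2)
    (hL : ∀ η : MultiIndex, Tendsto (fun k : ℕ => ∑ ν ∈ A k, vg ωp y η ν * Ψ ν)
      atTop (𝓝 (L η)))
    (hL2 : Summable fun η => ‖L η‖ ^ 2) : Ψ = 0 := by
  refine unique Ψ hΨ fun S0 w hw => ?_
  have hw2 : Summable fun i => ‖w i‖ ^ 2 :=
    summable_of_ne_finset_zero (s := S0) fun i hi => by simp [hw i hi]
  set t : Finset ℕ+ → ℕ+ → ℂ := fun S i => if i ∈ S then 0 else y i with ht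
  have htle : ∀ S i, ‖t S i‖ ^ 2 ≤ ‖y i‖ ^ 2 := by
    intro S i
    by_cases hi : i ∈ S <;> simp [ht, hi]
  have hts : ∀ S, Summable fun i => ‖t S i‖ ^ 2 := fun S =>
    Summable.of_nonneg_of_le (fun _ => by positivity) (htle S) hy
  have hy0 : 0 ≤ ∑' i, ‖y i‖ ^ 2 := tsum_nonneg fun _ => by positivity
  have hw0 : 0 ≤ ∑' i, ‖w i‖ ^ 2 := tsum_nonneg fun _ => by positivity
  have hF := weak atTop Ψ hΨ (fun S i => w i + t S i) w
    (2 * (∑' i, ‖w i‖ ^ 2) + 2 * (∑' i, ‖y i‖ ^ 2))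
    (fun S => (sq_sum_bound _ _ hw2 (hts S)).1)
    (fun S => (sq_sum_bound _ _ hw2 (hts S)).2.trans
      (by linarith [(hts S).tsum_le_tsum (htle S) hy]))
    hw2 (by linarith)
    (fun i => by
      refine tendsto_const_nhds.congr' ?_
      filter_upwards [eventually_ge_atTop ({i} : Finset ℕ+)] with S hS
      have : i ∈ S := hS (Finset.mem_singleton_self i)
      simp [ht, this])
  refine tendsto_nhds_unique hF ?_
  refine tendsto_const_nhds.congr fun S => ?_
  have hv := vanish ωp y hy h2 Ψ L hΨ hL hL2 (fun i => w i + (t S i - y i)) (S0 ∪ S) (fun i hi => by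
    rw [Finset.mem_union, not_or] at hi
    simp [hw i hi.1, ht, hi.2])
  have e : (fun i => w i + (t S i - y i) + y i) = fun i => w i + t S i := by
    funext i; ring
  simp only [e] at hv
  exact hv.symm

end VO

/-- If `∑|ω_{−i}|² < ∞` but `∑|ω_i|² = ∞`, the maximal domain of `V(ω)` is trivial:
if `Ψ ∈ ℓ²` is such that for every `η` the limit
`L_η = lim_{k→∞} ∑_{‖ν‖≤k} v_{η,ν}(ω)⟨e_ν,Ψ⟩` exists and `∑_η |L_η|² < ∞`, then `Ψ = 0`. -/
theorem stmt5 (ωp ωm : ℕ+ → ℂ)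
    (h1 : Summable fun i : ℕ+ => ‖ωm i‖ ^ 2)
    (h2 : ¬ Summable fun i : ℕ+ => ‖ωp i‖ ^ 2)
    (Ψ : MultiIndex → ℂ) (hΨ : Memℓp Ψ 2)
    (L : MultiIndex → ℂ)
    (hL : ∀ η : MultiIndex, Filter.Tendsto
      (fun k : ℕ => ∑' ν : {ν : MultiIndex // miWt ν ≤ k},
        vElem ωp ωm η (ν : MultiIndex) * Ψ (ν : MultiIndex))
      Filter.atTop (nhds (L η)))
    (hL2 : Summable fun η : MultiIndex => ‖L η‖ ^ 2) :
    Ψ = 0 := by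
  have hΨ' : Summable fun ν => ‖Ψ ν‖ ^ 2 := by
    have := (memℓp_gen_iff (by norm_num)).1 hΨ
    simpa using this
  refine VO.main ωp (fun i => - ωm i) (by simpa using h1) h2 Ψ L hΨ' (fun η => ?_) hL2
  refine (hL η).congr fun k => ?_
  rw [VO.tsum_A (fun ν => vElem ωp ωm η ν * Ψ ν) k]
  rfl
end

section
/- Let (t_i)_{i≥1} be a complex sequence with ∑_{i≥1}|t_i|²/i < ∞. Then the set of coherent states {c(t+t₀) : t₀ a finitely supported complex sequence} is total in H, i.e. its closed linear span equals H. -/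
/-- The coordinates of the coherent state `c(s)`:
`⟨e_μ, c(s)⟩ = exp(−(1/2)∑_{i≥1}|s_i|²/i)·∏_{i≥1} s_i^{μ_i}/√(μ_i!·i^{μ_i})`. -/
noncomputable def coherentCoord (s : ℕ+ → ℂ) (μ : MultiIndex) : ℂ :=
  Complex.exp (-(1 / 2 : ℂ) * ((∑' i : ℕ+, ‖s i‖ ^ 2 / ((i : ℕ) : ℝ) : ℝ) : ℂ)) *
    ∏ i ∈ μ.support,
      s i ^ (μ i) / ((Real.sqrt ((Nat.factorial (μ i) * (i : ℕ) ^ (μ i) : ℕ) : ℝ) : ℝ) : ℂ)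


open Filter Topology

/-- weight -/
noncomputable def cohW (μ : MultiIndex) : ℝ :=
  ∏ i ∈ μ.support, Real.sqrt ((Nat.factorial (μ i) * (i : ℕ) ^ (μ i) : ℕ) : ℝ)

lemma cohW_pos (μ : MultiIndex) : 0 < cohW μ := by
  unfold cohW
  refine Finset.prod_pos fun i _ => Real.sqrt_pos.2 ?_
  have := Nat.factorial_pos (μ i)
  have := i.pos
  positivity

/-- monomial -/
noncomputable def cohM (s : ℕ+ → ℂ) (μ : MultiIndex) : ℂ := ∏ i ∈ μ.support, s i ^ μ i

lemma coherentCoord_eq (s : ℕ+ → ℂ) (μ : MultiIndex) :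
    coherentCoord s μ =
      Complex.exp (-(1 / 2 : ℂ) * ((∑' i : ℕ+, ‖s i‖ ^ 2 / ((i : ℕ) : ℝ) : ℝ) : ℂ)) *
      (cohM s μ / (cohW μ : ℂ)) := by
  simp only [coherentCoord, cohM, cohW, Finset.prod_div_distrib, Complex.ofReal_prod]

lemma norm_cohM (s : ℕ+ → ℂ) (μ : MultiIndex) :
    ‖cohM s μ‖ = ∏ i ∈ μ.support, ‖s i‖ ^ μ i := by
  simp [cohM, norm_prod]

lemma summable_prod_exp (x : ℕ+ → ℝ) (hx0 : ∀ i, 0 ≤ x i) (hx : Summable x) :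
    Summable fun μ : MultiIndex => ∏ i ∈ μ.support, (x i ^ μ i / (Nat.factorial (μ i) : ℝ)) := by
  classical
  have h0 : ∀ (i : ℕ+) (k : ℕ), 0 ≤ x i ^ k / (Nat.factorial k : ℝ) := fun i k => by
    have := hx0 i
    positivity
  refine summable_of_sum_le (c := Real.exp (∑' i, x i))
    (fun μ => Finset.prod_nonneg fun i _ => h0 i _) fun T => ?_
  set S : Finset ℕ+ := T.biUnion fun μ => μ.support with hS
  have hsup : ∀ μ ∈ T, μ.support ⊆ S := fun μ hμ => Finset.subset_biUnion_of_mem _ hμ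
  set N : ℕ := T.sup fun μ => μ.degree with hN
  have hle : ∀ μ ∈ T, ∀ i, μ i ≤ N := fun μ hμ i =>
    (Finsupp.le_degree i μ).trans (Finset.le_sup (f := fun μ : MultiIndex => μ.degree) hμ)
  let φ : MultiIndex → (∀ i ∈ S, ℕ) := fun μ i _ => μ i
  have hinj : Set.InjOn φ T := by
    intro μ hμ ν hν h
    ext i
    by_cases hi : i ∈ S
    · exact congrFun (congrFun h i) hi
    · rw [Finsupp.notMem_support_iff.1 fun h => hi (hsup μ hμ h),
        Finsupp.notMem_support_iff.1 fun h => hi (hsup ν hν h)]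
  calc ∑ μ ∈ T, ∏ i ∈ μ.support, (x i ^ μ i / (Nat.factorial (μ i) : ℝ))
      = ∑ μ ∈ T, ∏ i ∈ S.attach, (x i ^ φ μ i i.2 / (Nat.factorial (φ μ i i.2) : ℝ)) := by
        refine Finset.sum_congr rfl fun μ hμ => ?_
        rw [Finset.prod_attach S (fun i => x i ^ μ i / (Nat.factorial (μ i) : ℝ))]
        refine Finset.prod_subset (hsup μ hμ) fun i _ hi => ?_
        rw [Finsupp.notMem_support_iff.1 hi]; simp
    _ = ∑ p ∈ T.image φ, ∏ i ∈ S.attach, (x i ^ p i i.2 / (Nat.factorial (p i i.2) : ℝ)) := by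
        rw [Finset.sum_image hinj]
    _ ≤ ∑ p ∈ S.pi fun _ => Finset.range (N + 1),
          ∏ i ∈ S.attach, (x i ^ p i i.2 / (Nat.factorial (p i i.2) : ℝ)) := by
        refine Finset.sum_le_sum_of_subset_of_nonneg ?_
          fun p _ _ => Finset.prod_nonneg fun i _ => h0 _ _
        intro p hp
        obtain ⟨μ, hμ, rfl⟩ := Finset.mem_image.1 hp
        rw [Finset.mem_pi]
        intro i hi
        exact Finset.mem_range.2 (Nat.lt_succ_of_le (hle μ hμ i))
    _ = ∏ i ∈ S, ∑ k ∈ Finset.range (N + 1), x i ^ k / (Nat.factorial k : ℝ) := by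
        rw [Finset.prod_sum]
    _ ≤ ∏ i ∈ S, Real.exp (x i) :=
        Finset.prod_le_prod (fun i _ => Finset.sum_nonneg fun k _ => h0 i k)
          fun i _ => Real.sum_le_exp_of_nonneg (hx0 i) _
    _ = Real.exp (∑ i ∈ S, x i) := (Real.exp_sum _ _).symm
    _ ≤ _ := Real.exp_le_exp.2 (hx.sum_le_tsum _ fun i _ => hx0 i)

lemma summable_sq (s : ℕ+ → ℂ) (hs : Summable fun i : ℕ+ => ‖s i‖ ^ 2 / ((i : ℕ) : ℝ)) :
    Summable fun μ : MultiIndex => ‖cohM s μ / (cohW μ : ℂ)‖ ^ 2 := by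
  refine (summable_prod_exp _ (fun i => by positivity) hs).congr fun μ => ?_
  rw [norm_div, norm_cohM, Complex.norm_real, Real.norm_of_nonneg (cohW_pos μ).le, cohW,
    ← Finset.prod_div_distrib, ← Finset.prod_pow]
  refine Finset.prod_congr rfl fun i _ => ?_
  rw [div_pow (‖s i‖ ^ μ i), Real.sq_sqrt (by positivity)]
  push_cast
  rw [div_pow, div_div, ← pow_mul, ← pow_mul, mul_comm 2, mul_comm (Nat.factorial _ : ℝ)]

lemma powerSeries_zero (b : ℕ → ℂ) (h : ∀ z : ℂ, HasSum (fun n => b n * z ^ n) 0) (n : ℕ) :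
    b n = 0 := by
  have h1 : HasFPowerSeriesAt (0 : ℂ → ℂ) (FormalMultilinearSeries.ofScalars ℂ b) 0 := by
    rw [hasFPowerSeriesAt_iff]
    refine Eventually.of_forall fun z => ?_
    simpa [FormalMultilinearSeries.coeff_ofScalars, mul_comm] using h z
  have h2 := h1.eq_zero
  have := congrArg (fun p => FormalMultilinearSeries.coeff p n) h2
  simp only [FormalMultilinearSeries.coeff_ofScalars] at this
  rw [this]
  rfl

lemma coeff_zero (A : MultiIndex → ℂ)
    (hsum : ∀ r : ℕ+ →₀ ℂ, HasSum (fun μ => A μ * cohM r μ) 0) (ν : MultiIndex) : A ν = 0 := by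
  classical
  set S := ν.support
  -- homogeneous parts
  have key : ∀ (r : ℕ+ → ℂ) (d : ℕ), ∑ μ ∈ S.finsuppAntidiag d, A μ * cohM r μ = 0 := by
    intro r d
    refine powerSeries_zero (fun d => ∑ μ ∈ S.finsuppAntidiag d, A μ * cohM r μ) (fun z => ?_) d
    let q : ℕ+ →₀ ℂ := Finsupp.onFinset S (fun i => if i ∈ S then z * r i else 0) (by
      intro i; simp; tauto)
    have hq : ∀ i, q i = if i ∈ S then z * r i else 0 := fun i => rfl
    have hs := hsum q
    let e := Equiv.sigmaFiberEquiv (fun μ : MultiIndex => μ.degree)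
    have hs2 := (e.hasSum_iff.2 hs)
    refine hs2.sigma fun k => ?_
    -- fiber
    let F : MultiIndex → ℂ := fun μ => A μ * cohM q μ
    change HasSum (F ∘ ((↑) : {μ : MultiIndex // μ.degree = k} → MultiIndex)) _
    have : HasSum (Set.indicator {μ : MultiIndex | μ.degree = k} F)
        ((∑ μ ∈ S.finsuppAntidiag k, A μ * cohM r μ) * z ^ k) := by
      have h3 : (∑ μ ∈ S.finsuppAntidiag k, A μ * cohM r μ) * z ^ k
          = ∑ μ ∈ S.finsuppAntidiag k, Set.indicator {μ : MultiIndex | μ.degree = k} F μ := by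
        rw [Finset.sum_mul]
        refine Finset.sum_congr rfl fun μ hμ => ?_
        obtain ⟨h4, h5⟩ := Finset.mem_finsuppAntidiag.1 hμ
        have h6 : μ.degree = k := by
          rw [← h4, Finsupp.degree]
          exact Finset.sum_subset h5 fun i _ hi => Finsupp.notMem_support_iff.1 hi
        rw [Set.indicator_of_mem (by exact h6)]
        simp only [F, cohM]
        rw [mul_assoc, ← h6, Finsupp.degree]
        congr 1
        change _ * z ^ (∑ i ∈ μ.support, μ i) = _
        rw [← Finset.prod_pow_eq_pow_sum, ← Finset.prod_mul_distrib]
        refine Finset.prod_congr rfl fun i hi => ?_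
        rw [hq, if_pos (h5 hi), mul_pow, mul_comm]
      rw [h3]
      refine hasSum_sum_of_ne_finset_zero fun μ hμ => ?_
      by_cases h6 : μ.degree = k
      · rw [Set.indicator_of_mem (by exact h6)]
        have h7 : ¬ μ.support ⊆ S := by
          intro h5
          apply hμ
          rw [Finset.mem_finsuppAntidiag]
          refine ⟨?_, h5⟩
          rw [← h6, Finsupp.degree]
          exact (Finset.sum_subset h5 fun i _ hi => Finsupp.notMem_support_iff.1 hi).symm
        obtain ⟨i, hi, hiS⟩ := Finset.not_subset.1 h7
        have : cohM q μ = 0 := Finset.prod_eq_zero hi (by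
          rw [hq, if_neg hiS]; exact zero_pow (Finsupp.mem_support_iff.1 hi))
        simp [F, this]
      · exact Set.indicator_of_notMem (s := {μ : MultiIndex | μ.degree = k}) h6 F
    exact hasSum_subtype_iff_indicator.2 this
  set d := ν.degree
  let P : MvPolynomial ℕ+ ℂ := ∑ μ ∈ S.finsuppAntidiag d, MvPolynomial.monomial μ (A μ)
  have hP : P = 0 := by
    apply MvPolynomial.funext
    intro r
    rw [map_zero, ← key r d, map_sum]
    refine Finset.sum_congr rfl fun μ _ => ?_
    rw [MvPolynomial.eval_monomial]; rfl
  have h1 := congrArg (MvPolynomial.coeff ν) hP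
  have hν : ν ∈ S.finsuppAntidiag d := Finset.mem_finsuppAntidiag.2 ⟨rfl, subset_rfl⟩
  simp only [P, MvPolynomial.coeff_sum, MvPolynomial.coeff_monomial, MvPolynomial.coeff_zero] at h1
  rw [Finset.sum_ite_eq' , if_pos hν] at h1
  exact h1

lemma summable_perturb (t s : ℕ+ → ℂ) (ht : Summable fun i : ℕ+ => ‖t i‖ ^ 2 / ((i : ℕ) : ℝ))
    (S : Finset ℕ+) (h : ∀ i ∉ S, ‖s i‖ = ‖t i‖) :
    Summable fun i : ℕ+ => ‖s i‖ ^ 2 / ((i : ℕ) : ℝ) := by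
  refine (summable_congr_cofinite ?_).1 ht
  have : ∀ᶠ i in cofinite, i ∉ S := by
    exact S.finite_toSet.compl_mem_cofinite
  filter_upwards [this] with i hi
  rw [h i hi]

theorem stmt6 (t : ℕ+ → ℂ) (ht : Summable fun i : ℕ+ => ‖t i‖ ^ 2 / ((i : ℕ) : ℝ)) :
    (Submodule.span ℂ {x : lp (fun _ : MultiIndex => ℂ) 2 |
        ∃ t₀ : ℕ+ →₀ ℂ, ∀ μ : MultiIndex,
          x μ = coherentCoord (fun i => t i + t₀ i) μ}).topologicalClosure = ⊤ := by
  classical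
  rw [Submodule.topologicalClosure_eq_top_iff, Submodule.eq_bot_iff]
  intro f hf
  set A : MultiIndex → ℂ := fun μ => (starRingEnd ℂ) (f μ) / (cohW μ : ℂ) with hA
  have hf2 : Summable fun μ => ‖f μ‖ ^ 2 := by
    have := (lp.memℓp f).summable (by norm_num)
    simpa using this
  -- absolute summability
  have habs : ∀ s : ℕ+ → ℂ, (Summable fun i : ℕ+ => ‖s i‖ ^ 2 / ((i : ℕ) : ℝ)) →
      Summable fun μ => ‖A μ * cohM s μ‖ := by
    intro s hs
    refine Summable.of_nonneg_of_le (fun _ => norm_nonneg _) (fun μ => ?_)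
      (hf2.add (summable_sq s hs))
    have h1 : ‖A μ * cohM s μ‖ = ‖f μ‖ * ‖cohM s μ / (cohW μ : ℂ)‖ := by
      simp only [hA, norm_mul, norm_div, RCLike.norm_conj]; ring
    rw [h1]
    nlinarith [sq_nonneg (‖f μ‖ - ‖cohM s μ / (cohW μ : ℂ)‖), sq_nonneg (‖f μ‖),
      sq_nonneg (‖cohM s μ / (cohW μ : ℂ)‖)]
  -- orthogonality
  have hort : ∀ t₀ : ℕ+ →₀ ℂ, ∑' μ, A μ * cohM (fun i => t i + t₀ i) μ = 0 := by
    intro t₀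
    set s : ℕ+ → ℂ := fun i => t i + t₀ i with hs
    have hsS : Summable fun i : ℕ+ => ‖s i‖ ^ 2 / ((i : ℕ) : ℝ) :=
      summable_perturb t s ht t₀.support fun i hi => by
        simp [hs, Finsupp.notMem_support_iff.1 hi]
    set C := Complex.exp (-(1 / 2 : ℂ) * ((∑' i : ℕ+, ‖s i‖ ^ 2 / ((i : ℕ) : ℝ) : ℝ) : ℂ)) with hC
    have hC0 : C ≠ 0 := Complex.exp_ne_zero _
    have hmem : Memℓp (fun μ : MultiIndex => (coherentCoord s μ : ℂ)) 2 := by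
      apply memℓp_gen
      have : Summable fun μ : MultiIndex => ‖coherentCoord s μ‖ ^ 2 := by
        refine ((summable_sq s hsS).mul_left (‖C‖ ^ 2)).congr fun μ => ?_
        rw [coherentCoord_eq, norm_mul, mul_pow]
      simpa using this
    let x : lp (fun _ : MultiIndex => ℂ) 2 := ⟨_, hmem⟩
    have hx := (Submodule.mem_orthogonal' _ f).1 hf x
      (Submodule.subset_span ⟨t₀, fun μ => rfl⟩)
    rw [lp.inner_eq_tsum] at hx
    have : ∀ μ, inner ℂ (f μ) (x μ) = C * (A μ * cohM s μ) := by
      intro μ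
      have : x μ = coherentCoord s μ := rfl
      rw [this, coherentCoord_eq, RCLike.inner_apply]
      simp only [hA]; ring
    simp only [this, tsum_mul_left] at hx
    exact (mul_eq_zero.1 hx).resolve_left hC0
  -- pass to finitely supported
  have hfin : ∀ r : ℕ+ →₀ ℂ, HasSum (fun μ => A μ * cohM r μ) 0 := by
    intro r
    set U : ℕ+ → ℂ := fun i => ((‖t i‖ + ‖r i‖ : ℝ) : ℂ) with hU
    have hUn : ∀ i, ‖U i‖ = ‖t i‖ + ‖r i‖ := fun i => by
      rw [hU, Complex.norm_real, Real.norm_of_nonneg (by positivity)]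
    have hUS := summable_perturb t U ht r.support fun i hi => by
      rw [hUn, Finsupp.notMem_support_iff.1 hi]; simp
    let w : Finset ℕ+ → ℕ+ → ℂ := fun S i => (if i ∈ S then 0 else t i) + r i
    have hw : ∀ S, ∑' μ, A μ * cohM (w S) μ = 0 := by
      intro S
      let q : ℕ+ →₀ ℂ := Finsupp.onFinset S (fun i => if i ∈ S then - t i else 0) (by
        intro i; simp; tauto)
      have := hort (q + r)
      convert this using 5 with μ
      funext i
      have hq : q i = if i ∈ S then - t i else 0 := rfl
      simp only [w, Finsupp.add_apply, hq]
      split_ifs <;> ring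
    have hle : ∀ s : ℕ+ → ℂ, (∀ i, ‖s i‖ ≤ ‖U i‖) → ∀ μ, ‖A μ * cohM s μ‖ ≤ ‖A μ * cohM U μ‖ := by
      intro s hs μ
      rw [norm_mul, norm_mul, norm_cohM, norm_cohM]
      refine mul_le_mul_of_nonneg_left (Finset.prod_le_prod (fun i _ => by positivity)
        fun i _ => pow_le_pow_left₀ (norm_nonneg _) (hs i) _) (norm_nonneg _)
    have hlim : Tendsto (fun S => ∑' μ, A μ * cohM (w S) μ) atTop (𝓝 (∑' μ, A μ * cohM r μ)) := by
      refine tendsto_tsum_of_dominated_convergence (habs U hUS) (fun μ => ?_)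
        (Eventually.of_forall fun S μ => hle _ (fun i => ?_) μ)
      · refine tendsto_const_nhds.congr' ?_
        filter_upwards [eventually_ge_atTop μ.support] with S hS
        congr 1
        refine Finset.prod_congr rfl fun i hi => ?_
        simp [w, hS hi]
      · rw [hUn]
        refine (norm_add_le _ _).trans (add_le_add_left ?_ _)
        split_ifs <;> simp
    simp only [hw] at hlim
    have h0 := tendsto_nhds_unique hlim tendsto_const_nhds
    have hsm : Summable fun μ => A μ * cohM r μ :=
      Summable.of_norm ((habs U hUS).of_nonneg_of_le (fun _ => norm_nonneg _)
        (hle r fun i => by rw [hUn]; simp))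
    rw [← h0]
    exact hsm.hasSum
  ext μ
  have h := coeff_zero A hfin μ
  have hW : (cohW μ : ℂ) ≠ 0 := by exact_mod_cast (cohW_pos μ).ne'
  simp only [hA, div_eq_zero_iff, hW, or_false, map_eq_zero] at h
  simpa using h
end

section
/- Under these hypotheses, V_k^S = {0} for all sufficiently large k, and ∑_{k≥1} dim V_k^S = ord₀(det S). -/
open Filter Topology Matrix

/-- `V_k^S`: the set of vectors `f 0`, where `f` is analytic near `0` and `S z *ᵥ f z`
vanishes to order at least `k` at `0`. -/
def VkSet {n : ℕ} (S : ℂ → Matrix (Fin n) (Fin n) ℂ) (k : ℕ) : Set (Fin n → ℂ) :=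
  {v | ∃ f g : ℂ → Fin n → ℂ,
    (∀ i, AnalyticAt ℂ (fun z => f z i) 0) ∧
    (∀ i, AnalyticAt ℂ (fun z => g z i) 0) ∧
    f 0 = v ∧
    ∀ᶠ z in 𝓝 (0 : ℂ), S z *ᵥ f z = z ^ k • g z}

theorem smith_matrix {R : Type*} [CommRing R] [IsDomain R] [IsPrincipalIdealRing R] {n : ℕ}
    (S : Matrix (Fin n) (Fin n) R) (hS : S.det ≠ 0) :
    ∃ (P Q : Matrix (Fin n) (Fin n) R) (a : Fin n → R), IsUnit P ∧ IsUnit Q ∧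
      S * P = Q * diagonal a := by
  have hinj : Function.Injective (Matrix.mulVecLin S) := by
    rw [← LinearMap.ker_eq_bot, LinearMap.ker_eq_bot']
    intro m hm
    exact Matrix.eq_zero_of_mulVec_eq_zero hS (by simpa using hm)
  let e := LinearEquiv.ofInjective (Matrix.mulVecLin S) hinj
  obtain ⟨bM, a, bN, h⟩ := Submodule.exists_smith_normal_form_of_rank_eq
    (N := LinearMap.range (Matrix.mulVecLin S)) (Pi.basisFun R (Fin n)) e.symm.finrank_eq
  let c := bN.map e.symm
  have hc : ∀ i, S *ᵥ c i = a i • bM i := by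
    intro i
    rw [← h i]
    have : e (c i) = bN i := by simp [c]
    rw [← this]
    rfl
  have key : ∀ b : Module.Basis (Fin n) R (Fin n → R), IsUnit ((Pi.basisFun R (Fin n)).toMatrix b) := by
    intro b
    have := (Pi.basisFun R (Fin n)).invertibleToMatrix b
    exact isUnit_of_invertible _
  refine ⟨_, _, a, key c, key bM, ?_⟩
  ext i j
  have := congrFun (hc j) i
  simp only [Matrix.mul_diagonal]
  simpa [Matrix.mul_apply, Module.Basis.toMatrix_apply, mulVec, dotProduct, mul_comm] using this

theorem abs_thm {R : Type*} [CommRing R] [IsDomain R] [IsPrincipalIdealRing R] {n : ℕ}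
    (X : R) (hX0 : X ≠ 0) (hfac : ∀ x : R, x ≠ 0 → ∃ (m : ℕ) (u : Rˣ), x = X ^ m * u)
    (ev : R →+* ℂ) (hev : Function.Surjective ev) (hevX : ev X = 0)
    (S : Matrix (Fin n) (Fin n) R) (d : ℕ) (w : Rˣ) (hdet : S.det = X ^ d * w) :
    ∃ (c : Fin n → Fin n → ℂ) (κ : Fin n → ℕ), LinearIndependent ℂ c ∧ ∑ i, κ i = d ∧
      ∀ (k : ℕ) (v : Fin n → ℂ),
        (∃ f g : Fin n → R, (∀ i, ev (f i) = v i) ∧ S *ᵥ f = X ^ k • g) ↔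
          v ∈ Submodule.span ℂ (c '' {i | k ≤ κ i}) := by
  have hXu : ¬ IsUnit X := fun h => by
    have := h.map ev
    simp [hevX] at this
  obtain ⟨P, Q, a, hP, hQ, hSP⟩ := smith_matrix S (by rw [hdet]; simp [hX0])
  have hdd := congrArg Matrix.det hSP
  rw [det_mul, det_mul, det_diagonal, hdet] at hdd
  have hPd := (Matrix.isUnit_iff_isUnit_det _).1 hP
  have hQd := (Matrix.isUnit_iff_isUnit_det _).1 hQ
  have ha : ∀ i, a i ≠ 0 := by
    intro i hi
    rw [Finset.prod_eq_zero (Finset.mem_univ i) hi] at hdd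
    simp [hX0, hPd.ne_zero] at hdd
  choose κ ua hκ using fun i => hfac (a i) (ha i)
  refine ⟨fun i j => ev (P j i), κ, ?_, ?_, ?_⟩
  · have : IsUnit (P.map ev) := hP.map ev.mapMatrix
    exact Matrix.linearIndependent_cols_of_isUnit this
  · have h1 : ∏ i, a i = X ^ (∑ i, κ i) * ((∏ i, ua i : Rˣ) : R) := by
      rw [Finset.prod_congr rfl (fun i _ => hκ i), Finset.prod_mul_distrib, Finset.prod_pow_eq_pow_sum]
      simp
    have h2 : Associated (X ^ d) (X ^ (∑ i, κ i)) := by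
      obtain ⟨p, hp⟩ := hPd
      obtain ⟨q, hq⟩ := hQd
      rw [h1, ← hp, ← hq] at hdd
      refine ⟨w * p * q⁻¹ * (∏ i, ua i)⁻¹, ?_⟩
      have : X ^ d * ↑w * (p : R) * ↑q⁻¹ * ↑(∏ i, ua i)⁻¹ = X ^ (∑ i, κ i) := by
        rw [hdd, Units.mul_inv_eq_iff_eq_mul, Units.mul_inv_eq_iff_eq_mul]; ring
      rw [← this]; simp only [Units.val_mul]; ring
    exact le_antisymm ((pow_dvd_pow_iff hX0 hXu).1 h2.dvd') ((pow_dvd_pow_iff hX0 hXu).1 h2.dvd)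
  · intro k v
    constructor
    · rintro ⟨f, g, hf, hfg⟩
      obtain ⟨P', hP'⟩ := hP.exists_right_inv
      obtain ⟨Q', hQ'⟩ := hQ.exists_left_inv
      let y := P' *ᵥ f
      have hy : P *ᵥ y = f := by simp [y, hP']
      have hay : diagonal a *ᵥ y = X ^ k • (Q' *ᵥ g) := by
        rw [← mulVec_smul, ← hfg, ← hy, mulVec_mulVec y S, hSP, mulVec_mulVec y Q', ← mul_assoc, hQ',
          one_mul]
      have hy0 : ∀ i, ¬ k ≤ κ i → ev (y i) = 0 := by
        intro i hi
        have h4 := congrFun hay i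
        rw [mulVec_diagonal, hκ, Pi.smul_apply, smul_eq_mul] at h4
        obtain ⟨l, rfl⟩ : ∃ l, k = κ i + (l + 1) := ⟨k - κ i - 1, by omega⟩
        have h5 : (ua i : R) * y i = X ^ (l + 1) * (Q' *ᵥ g) i := by
          apply mul_left_cancel₀ (pow_ne_zero (κ i) hX0)
          rw [← mul_assoc, h4]; ring
        have h6 := congrArg ev h5
        simp only [map_mul, map_pow, hevX, ne_eq, Nat.succ_ne_zero, not_false_eq_true, zero_pow,
          zero_mul, mul_eq_zero] at h6
        exact h6.resolve_left ((ua i).isUnit.map ev).ne_zero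
      have hv : v = ∑ i, ev (y i) • (fun j => ev (P j i)) := by
        ext j
        rw [← hf j, ← hy]
        simp [mulVec, dotProduct, mul_comm]
      rw [hv]
      refine Submodule.sum_mem _ fun i _ => ?_
      by_cases hi : k ≤ κ i
      · exact Submodule.smul_mem _ _ (Submodule.subset_span ⟨i, hi, rfl⟩)
      · rw [hy0 i hi, zero_smul]; exact zero_mem _
    · intro hv
      induction hv using Submodule.span_induction with
      | mem x hx =>
        obtain ⟨i, hi, rfl⟩ := hx
        refine ⟨fun j => P j i, fun j => Q j i * (X ^ (κ i - k) * ua i), fun _ => rfl, ?_⟩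
        ext j
        have := congrFun (congrFun hSP j) i
        rw [mul_diagonal, hκ] at this
        have h3 : X ^ κ i = X ^ k * X ^ (κ i - k) := by
          rw [← pow_add, Nat.add_sub_cancel' hi]
        refine Eq.trans this ?_
        rw [h3]; simp; ring
      | zero => exact ⟨0, 0, by simp, by simp⟩
      | add x y _ _ hx hy =>
        obtain ⟨f, g, hf, hfg⟩ := hx
        obtain ⟨f', g', hf', hfg'⟩ := hy
        exact ⟨f + f', g + g', by simp [hf, hf'], by rw [mulVec_add, hfg, hfg', smul_add]⟩
      | smul t x _ hx =>
        obtain ⟨f, g, hf, hfg⟩ := hx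
        obtain ⟨r, rfl⟩ := hev t
        exact ⟨r • f, r • g, by simp [hf], by rw [mulVec_smul, hfg, smul_comm]⟩

theorem abs_sum {n : ℕ} (κ : Fin n → ℕ) (d : ℕ) (hd : ∑ i, κ i = d) :
    ∑ k ∈ Finset.Icc 1 (d + 1), (Finset.univ.filter (fun i => k ≤ κ i)).card = d := by
  simp only [Finset.card_filter]
  rw [Finset.sum_comm]
  conv_rhs => rw [← hd]
  refine Finset.sum_congr rfl fun i _ => ?_
  rw [← Finset.card_filter]
  have hi : κ i ≤ d := hd ▸ Finset.single_le_sum (fun _ _ => Nat.zero_le _) (Finset.mem_univ i)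
  have : (Finset.Icc 1 (d + 1)).filter (fun k => k ≤ κ i) = Finset.Icc 1 (κ i) := by
    ext k; simp; omega
  rw [this]; simp

/-- The ring of germs at `0` of analytic functions. -/
def AnGerm : Subring (Germ (𝓝 (0 : ℂ)) ℂ) where
  carrier := {g | ∃ f : ℂ → ℂ, AnalyticAt ℂ f 0 ∧ (f : Germ (𝓝 (0 : ℂ)) ℂ) = g}
  mul_mem' := by
    rintro _ _ ⟨f, hf, rfl⟩ ⟨g, hg, rfl⟩
    exact ⟨f * g, hf.mul hg, rfl⟩
  add_mem' := by
    rintro _ _ ⟨f, hf, rfl⟩ ⟨g, hg, rfl⟩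
    exact ⟨f + g, hf.add hg, rfl⟩
  neg_mem' := by
    rintro _ ⟨f, hf, rfl⟩
    exact ⟨-f, hf.neg, rfl⟩
  one_mem' := ⟨1, analyticAt_const, rfl⟩
  zero_mem' := ⟨0, analyticAt_const, rfl⟩

namespace AnGerm

/-- The germ of an analytic function. -/
noncomputable def mk (f : ℂ → ℂ) (hf : AnalyticAt ℂ f 0) : AnGerm := ⟨f, f, hf, rfl⟩

theorem exists_mk (x : AnGerm) : ∃ f hf, x = mk f hf := by
  obtain ⟨_, f, hf, rfl⟩ := x
  exact ⟨f, hf, rfl⟩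

theorem mk_eq {f g : ℂ → ℂ} (hf : AnalyticAt ℂ f 0) (hg : AnalyticAt ℂ g 0) :
    mk f hf = mk g hg ↔ ∀ᶠ z in 𝓝 (0 : ℂ), f z = g z := by
  refine Subtype.ext_iff.trans ?_
  exact Germ.coe_eq

/-- Evaluation at `0`. -/
noncomputable def ev : AnGerm →+* ℂ := (Germ.valueRingHom).comp AnGerm.subtype

theorem ev_mk {f : ℂ → ℂ} (hf : AnalyticAt ℂ f 0) : ev (mk f hf) = f 0 := rfl

/-- The germ of the identity. -/
noncomputable def X : AnGerm := mk (fun z => z) analyticAt_id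

theorem mk_mul {f g : ℂ → ℂ} (hf : AnalyticAt ℂ f 0) (hg : AnalyticAt ℂ g 0) :
    mk f hf * mk g hg = mk (fun z => f z * g z) (hf.mul hg) := rfl

theorem X_pow (k : ℕ) : X ^ k = mk (fun z => z ^ k) (analyticAt_id.pow k) := rfl

theorem zero_eq : (0 : AnGerm) = mk (fun _ => 0) analyticAt_const := rfl
theorem one_eq : (1 : AnGerm) = mk (fun _ => 1) analyticAt_const := rfl

theorem isUnit_mk {f : ℂ → ℂ} (hf : AnalyticAt ℂ f 0) (h0 : f 0 ≠ 0) : IsUnit (mk f hf) := by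
  refine IsUnit.of_mul_eq_one (mk (fun z => (f z)⁻¹) (hf.inv h0)) ?_
  rw [mk_mul, one_eq, mk_eq]
  filter_upwards [hf.continuousAt.eventually_ne h0] with z hz
  exact mul_inv_cancel₀ hz

theorem fac (x : AnGerm) (hx : x ≠ 0) : ∃ (m : ℕ) (u : AnGermˣ), x = X ^ m * u := by
  obtain ⟨f, hf, rfl⟩ := exists_mk x
  rw [zero_eq, Ne, mk_eq] at hx
  obtain ⟨m, g, hg, hg0, h⟩ := hf.exists_eventuallyEq_pow_smul_nonzero_iff.2 hx
  obtain ⟨u, hu⟩ := isUnit_mk hg hg0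
  refine ⟨m, u, ?_⟩
  rw [hu, X_pow, mk_mul, mk_eq]
  simpa using h

theorem ev_X : ev X = 0 := rfl

theorem X_pow_ne (m : ℕ) : X ^ m ≠ 0 := by
  rw [X_pow, zero_eq, Ne, mk_eq]
  intro h
  have h2 : ∀ᶠ z in 𝓝[≠] (0 : ℂ), False := by
    filter_upwards [h.filter_mono nhdsWithin_le_nhds, self_mem_nhdsWithin] with z hz hz'
    exact hz' (eq_zero_of_pow_eq_zero hz)
  exact h2.exists.choose_spec

instance : Nontrivial AnGerm := ev.domain_nontrivial

instance : IsDomain AnGerm := by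
  have : NoZeroDivisors AnGerm := by
    constructor
    intro a b hab
    by_contra! h
    obtain ⟨m, u, rfl⟩ := fac a h.1
    obtain ⟨l, v, rfl⟩ := fac b h.2
    apply X_pow_ne (m + l)
    have : X ^ (m + l) * ((u * v : AnGermˣ) : AnGerm) = 0 := by
      rw [← hab, pow_add]; push_cast; ring
    exact (Units.mul_left_eq_zero _).1 this
  exact NoZeroDivisors.to_isDomain _

theorem X_ne : X ≠ 0 := by simpa using X_pow_ne 1

theorem X_dvd (a : AnGerm) (ha : ¬ IsUnit a) : X ∣ a := by
  by_cases h : a = 0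
  · simp [h]
  obtain ⟨m, u, rfl⟩ := fac a h
  cases m with
  | zero => simp at ha
  | succ m => exact Dvd.intro (X ^ m * u) (by ring)

instance : IsPrincipalIdealRing AnGerm := by
  have hXu : ¬ IsUnit X := fun h => by
    have := h.map ev
    simp [ev_X] at this
  have : IsDiscreteValuationRing AnGerm := by
    apply IsDiscreteValuationRing.ofHasUnitMulPowIrreducibleFactorization
    refine ⟨X, ⟨hXu, ?_⟩, ?_⟩
    · intro a b hab
      by_contra! h
      obtain ⟨a', rfl⟩ := X_dvd a h.1
      obtain ⟨b', rfl⟩ := X_dvd b h.2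
      have : X * 1 = X * (X * (a' * b')) := by rw [mul_one]; conv_lhs => rw [hab]
                                               ring
      exact hXu (IsUnit.of_mul_eq_one _ (mul_left_cancel₀ X_ne this).symm)
    · intro x hx
      obtain ⟨m, u, rfl⟩ := fac x hx
      exact ⟨m, u, rfl⟩
  infer_instance

theorem mk_sum {n : ℕ} (h : Fin n → ℂ → ℂ) (hh : ∀ j, AnalyticAt ℂ (h j) 0)
    (hs : AnalyticAt ℂ (fun z => ∑ j, h j z) 0) :
    ∑ j, mk (h j) (hh j) = mk (fun z => ∑ j, h j z) hs := by
  apply Subtype.ext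
  have h1 : (fun z => ∑ j, h j z) = ∑ j, h j := by ext z; simp
  change AnGerm.subtype _ = Germ.coeRingHom (𝓝 (0 : ℂ)) (fun z => ∑ j, h j z)
  rw [h1, map_sum, map_sum]
  rfl

theorem mk_det {n : ℕ} (S : ℂ → Matrix (Fin n) (Fin n) ℂ)
    (hS : ∀ i j, AnalyticAt ℂ (fun z => S z i j) 0) (hd : AnalyticAt ℂ (fun z => (S z).det) 0) :
    (Matrix.of fun i j => mk (fun z => S z i j) (hS i j)).det = mk (fun z => (S z).det) hd := by
  apply Subtype.ext
  let F : Matrix (Fin n) (Fin n) (ℂ → ℂ) := Matrix.of fun i j z => S z i j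
  have h1 : (fun z => (S z).det) = F.det := by
    ext z
    exact ((Pi.evalRingHom (fun _ : ℂ => ℂ) z).map_det F).symm
  change AnGerm.subtype _ = Germ.coeRingHom (𝓝 (0 : ℂ)) (fun z => (S z).det)
  rw [h1, RingHom.map_det, RingHom.map_det]
  rfl

end AnGerm

open AnGerm in
theorem vk_iff {n : ℕ} (S : ℂ → Matrix (Fin n) (Fin n) ℂ)
    (hS : ∀ i j, AnalyticAt ℂ (fun z => S z i j) 0) (k : ℕ) (v : Fin n → ℂ) :
    v ∈ VkSet S k ↔ ∃ f g : Fin n → AnGerm, (∀ i, ev (f i) = v i) ∧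
      (Matrix.of fun i j => mk (fun z => S z i j) (hS i j)) *ᵥ f = X ^ k • g := by
  have key : ∀ (f g : ℂ → Fin n → ℂ) (hf : ∀ i, AnalyticAt ℂ (fun z => f z i) 0)
      (hg : ∀ i, AnalyticAt ℂ (fun z => g z i) 0),
      ((Matrix.of fun i j => mk (fun z => S z i j) (hS i j)) *ᵥ (fun i => mk _ (hf i))
        = X ^ k • (fun i => mk _ (hg i))) ↔ ∀ᶠ z in 𝓝 (0 : ℂ), S z *ᵥ f z = z ^ k • g z := by
    intro f g hf hg
    simp only [funext_iff, Filter.eventually_all]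
    refine forall_congr' fun i => ?_
    simp only [mulVec, dotProduct, Matrix.of_apply, Pi.smul_apply, smul_eq_mul, mk_mul, X_pow]
    rw [mk_sum (fun j z => S z i j * f z j) (fun j => (hS i j).mul (hf j))
      (Finset.analyticAt_fun_sum _ fun j _ => (hS i j).mul (hf j)), mk_eq]
  constructor
  · rintro ⟨f, g, hf, hg, rfl, h⟩
    exact ⟨fun i => mk _ (hf i), fun i => mk _ (hg i), fun i => rfl, (key f g hf hg).2 h⟩
  · rintro ⟨f, g, hfv, h⟩
    choose f' hf' hff using fun i => exists_mk (f i)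
    choose g' hg' hgg using fun i => exists_mk (g i)
    obtain rfl : f = fun i => mk _ (hf' i) := funext hff
    obtain rfl : g = fun i => mk _ (hg' i) := funext hgg
    exact ⟨fun z i => f' i z, fun z i => g' i z, hf', hg', funext hfv,
      (key (fun z i => f' i z) (fun z i => g' i z) hf' hg').1 h⟩

/-- If `S : ℂ → Mₙ(ℂ)` is analytic near `0`, invertible for `0 < |z| < ε`, and
`det (S z) = z^d·u z` with `u` analytic and `u 0 ≠ 0` (so `d = ord₀ (det S)`), then
`V_k^S = {0}` for all sufficiently large `k`, and `∑_{k≥1} dim V_k^S = ord₀ (det S)`. -/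
theorem stmt9 (n : ℕ) (hn : 1 ≤ n) (S : ℂ → Matrix (Fin n) (Fin n) ℂ)
    (hS : ∀ i j, AnalyticAt ℂ (fun z => S z i j) 0)
    (hinv : ∃ ε > (0 : ℝ), ∀ z : ℂ, z ≠ 0 → ‖z‖ < ε → IsUnit (S z))
    (d : ℕ) (u : ℂ → ℂ) (hu : AnalyticAt ℂ u 0) (hu0 : u 0 ≠ 0)
    (hdet : ∀ᶠ z in 𝓝 (0 : ℂ), (S z).det = z ^ d * u z) :
    ∃ K : ℕ, (∀ k ≥ K, VkSet S k = {0}) ∧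
      ∑ k ∈ Finset.Icc 1 K, Module.finrank ℂ (Submodule.span ℂ (VkSet S k)) = d := by
  have hd : AnalyticAt ℂ (fun z => (S z).det) 0 := by
    refine AnalyticAt.congr ((analyticAt_id.pow d).mul hu) ?_
    filter_upwards [hdet] with z hz
    simp [hz]
  obtain ⟨w, hw⟩ := AnGerm.isUnit_mk hu hu0
  obtain ⟨c, κ, hc, hκ, hV⟩ := abs_thm AnGerm.X AnGerm.X_ne AnGerm.fac AnGerm.ev
    (fun t => ⟨AnGerm.mk (fun _ => t) analyticAt_const, rfl⟩) AnGerm.ev_X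
    (Matrix.of fun i j => AnGerm.mk (fun z => S z i j) (hS i j)) d w (by
      rw [AnGerm.mk_det S hS hd, hw, AnGerm.X_pow, AnGerm.mk_mul, AnGerm.mk_eq]
      exact hdet)
  have hV' : ∀ k, VkSet S k = (Submodule.span ℂ (c '' {i | k ≤ κ i}) : Set (Fin n → ℂ)) := by
    intro k
    ext v
    rw [vk_iff S hS, hV]
    rfl
  refine ⟨d + 1, ?_, ?_⟩
  · intro k hk
    have : {i | k ≤ κ i} = ∅ := by
      ext i
      have hi : κ i ≤ d :=
        hκ ▸ Finset.single_le_sum (fun _ _ => Nat.zero_le _) (Finset.mem_univ i)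
      simp only [Set.mem_ofPred_eq, Set.mem_empty_iff_false, iff_false]
      omega
    rw [hV', this]
    simp
  · refine Eq.trans ?_ (abs_sum κ d hκ)
    refine Finset.sum_congr rfl fun k _ => ?_
    rw [hV', Submodule.span_eq]
    have h7 : c '' {i | k ≤ κ i} =
        Set.range (c ∘ (Subtype.val : {i // k ≤ κ i} → Fin n)) := by
      ext x; simp
    rw [h7, finrank_span_eq_card (hc.comp _ Subtype.val_injective), Fintype.card_subtype]
end
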